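/- Let D and C be the N×N matrices with rows indexed by θ ∈ θ_p and columns by θ' ∈ θ_a given by D_{θ,θ'} = e^{−i(l−1/2)(θ−θ')}/(2iN·sin((θ'−θ)/2)) · (√(b_{θ'})/√(b_θ) + √(b_θ)/√(b_{θ'})) and C_{θ,θ'} = e^{−i(l−1/2)(θ+θ')}/(2iN·sin((θ+θ')/2)) · (√(b_θ)√(b_{θ'}) − 1/(√(b_θ)√(b_{θ'}))), and let B be the entrywise complex conjugate of C. Then D is invertible and, for θ, θ' ∈ θ_p, (B·D^{−1})_{θ,θ'} = −i·e^{i(l−1/2)(θ+θ')} · (sinh 2K_y/sinh 2K_x) · e^{−(ν_θ+ν_{θ'})/2} / (N·√(sinh γ_θ · sinh γ_{θ'})) · sin((θ−θ')/2)/sinh((γ_θ+γ_{θ'})/2). -/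

import Mathlib

open Finset

noncomputable section

/-- Antiperiodic momenta: θ_a = {(2j−1)π/N : j = 1,…,N}. -/
def thetaA (N : ℕ) (j : Fin N) : ℝ := (2 * (j : ℝ) + 1) * Real.pi / N

/-- Periodic momenta: θ_p = {2(j−1)π/N : j = 1,…,N}. -/
def thetaP (N : ℕ) (j : Fin N) : ℝ := (2 * (j : ℝ)) * Real.pi / N

/-- b_θ, the principal square root of
`(1−αe^{iθ})(1−βe^{−iθ}) / ((1−βe^{iθ})(1−αe^{−iθ}))`. -/
def bfun (α β θ : ℝ) : ℂ :=
  ((((1 : ℂ) - (α : ℂ) * Complex.exp (Complex.I * θ)) *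
      ((1 : ℂ) - (β : ℂ) * Complex.exp (-Complex.I * θ))) /
    (((1 : ℂ) - (β : ℂ) * Complex.exp (Complex.I * θ)) *
      ((1 : ℂ) - (α : ℂ) * Complex.exp (-Complex.I * θ)))) ^ ((2 : ℂ)⁻¹)

/-- √(b_θ), principal square root. -/
def sqb (α β θ : ℝ) : ℂ := bfun α β θ ^ ((2 : ℂ)⁻¹)

/-- The matrix D, rows indexed by θ ∈ θ_p, columns by θ' ∈ θ_a. -/
def Dmat (N : ℕ) (l : ℤ) (α β : ℝ) : Matrix (Fin N) (Fin N) ℂ :=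
  Matrix.of fun j k =>
    Complex.exp (-Complex.I * ((l : ℂ) - 2⁻¹) * ((thetaP N j : ℝ) - (thetaA N k : ℝ))) /
        (2 * Complex.I * N * Complex.sin ((((thetaA N k : ℝ) : ℂ) - (thetaP N j : ℝ)) / 2)) *
      (sqb α β (thetaA N k) / sqb α β (thetaP N j) +
        sqb α β (thetaP N j) / sqb α β (thetaA N k))

/-- The matrix C, rows indexed by θ ∈ θ_p, columns by θ' ∈ θ_a. -/
def Cmat (N : ℕ) (l : ℤ) (α β : ℝ) : Matrix (Fin N) (Fin N) ℂ :=
  Matrix.of fun j k =>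
    Complex.exp (-Complex.I * ((l : ℂ) - 2⁻¹) * ((thetaP N j : ℝ) + (thetaA N k : ℝ))) /
        (2 * Complex.I * N * Complex.sin ((((thetaP N j : ℝ) : ℂ) + (thetaA N k : ℝ)) / 2)) *
      (sqb α β (thetaP N j) * sqb α β (thetaA N k) -
        1 / (sqb α β (thetaP N j) * sqb α β (thetaA N k)))

/-- ν_θ = ln [∏_{θ'∈θ_a} sinh((γ_θ+γ_{θ'})/2) / ∏_{θ'∈θ_p} sinh((γ_θ+γ_{θ'})/2)]. -/
def nufun (N : ℕ) (γ : ℝ → ℝ) (θ : ℝ) : ℝ :=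
  Real.log ((∏ j : Fin N, Real.sinh ((γ θ + γ (thetaA N j)) / 2)) /
    (∏ j : Fin N, Real.sinh ((γ θ + γ (thetaP N j)) / 2)))

theorem nodal_eq_X_pow_sub_C {N : ℕ} (hN : N ≠ 0) {x : Fin N → ℂ}
    (hx : Function.Injective x) {c : ℂ} (hx1 : ∀ j, x j ^ N = c) :
    Lagrange.nodal univ x = Polynomial.X ^ N - Polynomial.C c := by
  have h1 : (Polynomial.C c).degree < ((Polynomial.X : Polynomial ℂ) ^ N).degree := by
    rw [Polynomial.degree_X_pow]
    exact Polynomial.degree_C_le.trans_lt (by exact_mod_cast Nat.pos_of_ne_zero hN)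
  apply Polynomial.eq_of_degree_le_of_eval_index_eq (v := x) univ hx.injOn
  · simp [Lagrange.degree_nodal]
  · rw [Lagrange.degree_nodal, Polynomial.degree_sub_eq_left_of_degree_lt h1]
    simp
  · rw [Lagrange.nodal_monic, Polynomial.leadingCoeff_sub_of_degree_lt h1]
    simp
  · intro j _
    rw [Lagrange.eval_nodal_at_node (mem_univ j)]
    simp [hx1]

/-- Partial fraction expansion over the `N`-th roots of unity. -/
theorem sum_rootsOfUnity_div_sub {N : ℕ} (hN : N ≠ 0) {x : Fin N → ℂ}
    (hx : Function.Injective x) (hx1 : ∀ j, x j ^ N = 1) {w : Polynomial ℂ}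
    (hw : w.degree < N) {t : ℂ} (ht : t ^ N ≠ 1) :
    ∑ j, x j / N * w.eval (x j) / (t - x j) = w.eval t / (t ^ N - 1) := by
  have hnodal := nodal_eq_X_pow_sub_C hN hx hx1
  have htx : ∀ j ∈ univ, t ≠ x j := fun j _ h => ht (h ▸ hx1 j)
  have key := Lagrange.eval_interpolate_not_at_node (fun j => w.eval (x j)) htx
  rw [← Lagrange.eq_interpolate hx.injOn (by simpa using hw), hnodal] at key
  have ht' : t ^ N - 1 ≠ 0 := sub_ne_zero.mpr ht
  rw [key]
  simp only [Polynomial.eval_sub, Polynomial.eval_pow, Polynomial.eval_X, Polynomial.eval_C]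
  rw [mul_div_cancel_left₀ _ ht']
  refine sum_congr rfl fun j _ => ?_
  rw [Lagrange.nodalWeight_eq_eval_derivative_nodal (mem_univ j), hnodal]
  have hxj : x j ≠ 0 := fun h => by simpa [h, hN] using hx1 j
  have hpow : x j ^ (N - 1) = (x j)⁻¹ := by
    apply eq_inv_of_mul_eq_one_left
    rw [← pow_succ, Nat.sub_add_cancel (Nat.pos_of_ne_zero hN), hx1]
  simp only [Polynomial.derivative_sub, Polynomial.derivative_X_pow, Polynomial.derivative_C,
    sub_zero, Polynomial.eval_mul, Polynomial.eval_C, Polynomial.eval_pow, Polynomial.eval_X, hpow]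
  field_simp

/-- Vanishing of the sum of residues of `v / ((z ^ N - 1) (z - a) (z - b))`. -/
theorem sum_residues_eq_zero {N : ℕ} (hN : N ≠ 0) {x : Fin N → ℂ}
    (hx : Function.Injective x) (hx1 : ∀ j, x j ^ N = 1) {v : Polynomial ℂ}
    (hv : v.natDegree ≤ N) {a b : ℂ} (ha : a ^ N ≠ 1) (hb : b ^ N ≠ 1) (hab : a ≠ b) :
    ∑ j, x j / N * v.eval (x j) / ((x j - a) * (x j - b)) +
      v.eval a / ((a ^ N - 1) * (a - b)) + v.eval b / ((b ^ N - 1) * (b - a)) = 0 := by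
  set w := v /ₘ (Polynomial.X - Polynomial.C b) with hw
  have hvw : ∀ z, v.eval z = (z - b) * w.eval z + v.eval b := by
    intro z
    conv_lhs => rw [← Polynomial.modByMonic_add_div v (Polynomial.X - Polynomial.C b),
      Polynomial.modByMonic_X_sub_C_eq_C_eval]
    simp only [Polynomial.eval_add, Polynomial.eval_C, Polynomial.eval_mul, Polynomial.eval_sub,
      Polynomial.eval_X, ← hw]
    ring
  have hwdeg : w.degree < N := by
    by_cases h0 : w = 0
    · rw [h0, Polynomial.degree_zero]; exact WithBot.bot_lt_coe N
    rw [Polynomial.degree_eq_natDegree h0, Nat.cast_lt, hw, Polynomial.natDegree_divByMonic v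
      (Polynomial.monic_X_sub_C b), Polynomial.natDegree_X_sub_C]
    omega
  have h1 := sum_rootsOfUnity_div_sub hN hx hx1 hwdeg ha
  have hone : (1 : Polynomial ℂ).degree < N := by simpa using Nat.pos_of_ne_zero hN
  have h2 := sum_rootsOfUnity_div_sub hN hx hx1 hone ha
  have h3 := sum_rootsOfUnity_div_sub hN hx hx1 hone hb
  simp only [Polynomial.eval_one] at h2 h3
  have hab' := sub_ne_zero.mpr hab
  have hba' := sub_ne_zero.mpr hab.symm
  have ha' := sub_ne_zero.mpr ha
  have hb' := sub_ne_zero.mpr hb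
  have hsum : ∑ j, x j / N * v.eval (x j) / ((x j - a) * (x j - b)) =
      -∑ j, x j / N * w.eval (x j) / (a - x j) - v.eval b / (a - b) *
        (∑ j, x j / N * 1 / (a - x j) - ∑ j, x j / N * 1 / (b - x j)) := by
    rw [← sum_sub_distrib, mul_sum, ← sum_neg_distrib, ← sum_sub_distrib]
    refine sum_congr rfl fun j _ => ?_
    have hja : x j - a ≠ 0 := sub_ne_zero.mpr fun h => ha (h ▸ hx1 j)
    have hjb : x j - b ≠ 0 := sub_ne_zero.mpr fun h => hb (h ▸ hx1 j)
    have hN' : (N : ℂ) ≠ 0 := Nat.cast_ne_zero.mpr hN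
    rw [hvw (x j), ← neg_sub (x j) a, ← neg_sub (x j) b]
    field_simp
    ring
  rw [hsum, h1, h2, h3, hvw a, ← neg_sub a b]
  field_simp
  ring

/-- Cauchy matrices are nonsingular. -/
theorem det_cauchy_ne_zero {N : ℕ} {x a : Fin N → ℂ} (hx : Function.Injective x)
    (ha : Function.Injective a) (hxa : ∀ j k, x j ≠ a k) :
    (Matrix.of fun j k => 1 / (x j - a k)).det ≠ 0 := by
  rw [Ne, ← Matrix.exists_mulVec_eq_zero_iff]
  rintro ⟨w, hw0, hw⟩
  apply hw0
  set p : Polynomial ℂ := ∑ k, Polynomial.C (w k) * Lagrange.nodal (univ.erase k) a with hp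
  have hpx : ∀ j ∈ univ, p.eval (x j) = 0 := by
    intro j _
    have hj := congrFun hw j
    simp only [Matrix.mulVec, dotProduct, Matrix.of_apply, Pi.zero_apply] at hj
    have : p.eval (x j) = (Lagrange.nodal univ a).eval (x j) * ∑ k, 1 / (x j - a k) * w k := by
      rw [hp, Polynomial.eval_finsetSum, mul_sum]
      refine sum_congr rfl fun k _ => ?_
      rw [Lagrange.nodal_eq_mul_nodal_erase (mem_univ k)]
      have := sub_ne_zero.mpr (hxa j k)
      simp only [Polynomial.eval_mul, Polynomial.eval_C, Polynomial.eval_sub, Polynomial.eval_X]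
      field_simp
    rw [this, hj, mul_zero]
  have hp0 : p = 0 := by
    refine Polynomial.eq_zero_of_degree_lt_of_eval_index_eq_zero univ hx.injOn ?_ hpx
    refine (Polynomial.degree_sum_le _ _).trans_lt ?_
    rw [Finset.sup_lt_iff (by exact WithBot.bot_lt_coe _)]
    intro k _
    rw [Polynomial.C_mul']
    refine (Polynomial.degree_smul_le _ _).trans_lt ?_
    rw [Lagrange.degree_nodal, Nat.cast_lt]
    exact card_erase_lt_of_mem (mem_univ k)
  funext k
  have hk : p.eval (a k) = 0 := by simp [hp0]
  rw [hp, Polynomial.eval_finsetSum, sum_eq_single k] at hk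
  · rw [Polynomial.eval_mul, Polynomial.eval_C, mul_eq_zero] at hk
    refine hk.resolve_right ?_
    refine Lagrange.eval_nodal_not_at_node fun i hi h => ?_
    exact (mem_erase.mp hi).1 (ha h).symm
  · intro i _ hik
    rw [Polynomial.eval_mul, Lagrange.eval_nodal_at_node (mem_erase.mpr ⟨hik.symm, mem_univ k⟩),
      mul_zero]
  · simp
theorem sinh_half_add_mul_sinh_half_sub (a b : ℝ) :
    Real.sinh ((a + b) / 2) * Real.sinh ((a - b) / 2) = (Real.cosh a - Real.cosh b) / 2 := by
  have h1 : Real.cosh a = Real.cosh ((a + b) / 2 + (a - b) / 2) := by ring_nf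
  have h2 : Real.cosh b = Real.cosh ((a + b) / 2 - (a - b) / 2) := by ring_nf
  rw [h1, h2, Real.cosh_add, Real.cosh_sub]
  ring

/-- `γ` is the nonnegative solution of the Onsager dispersion relation with parameters `u < w`. -/
structure IsDispersion (u w : ℝ) (γ : ℝ → ℝ) : Prop where
  pos : 0 < u
  lt : u < w
  nonneg : ∀ θ, 0 ≤ γ θ
  cosh_eq : ∀ θ, Real.cosh (γ θ) =
    Real.cosh u * Real.cosh w - Real.sinh u * Real.sinh w * Real.cos θ

/-- The Laurent polynomial whose unimodular normalization is `b_θ`. -/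
def symb (u w θ : ℝ) : ℂ :=
  ((Real.cosh u * Real.sinh w - Real.sinh u * Real.cosh w * Real.cos θ : ℝ) : ℂ) -
    Complex.I * ((Real.sinh u * Real.sin θ : ℝ) : ℂ)

theorem symb_re (u w θ : ℝ) : (symb u w θ).re =
    Real.cosh u * Real.sinh w - Real.sinh u * Real.cosh w * Real.cos θ := by
  simp only [symb, Complex.sub_re, Complex.ofReal_re, Complex.re_mul_ofReal, Complex.I_re,
    zero_mul, sub_zero]

theorem symb_im (u w θ : ℝ) : (symb u w θ).im = -(Real.sinh u * Real.sin θ) := by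
  simp only [symb, Complex.sub_im, Complex.ofReal_im, Complex.im_mul_ofReal, Complex.I_im,
    one_mul, zero_sub]

theorem conj_symb (u w θ : ℝ) : (starRingEnd ℂ) (symb u w θ) = symb u w (-θ) := by
  apply Complex.ext <;> simp [symb_re, symb_im]

theorem symb_neg_sub_symb (u w θ : ℝ) :
    symb u w (-θ) - symb u w θ = 2 * Complex.I * Real.sinh u * Real.sin θ := by
  simp only [symb, Real.cos_neg, Real.sin_neg]
  push_cast
  ring

theorem continuous_symb (u w : ℝ) : Continuous (symb u w) := by
  unfold symb
  fun_prop

namespace IsDispersion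

variable {u w : ℝ} {γ : ℝ → ℝ}

theorem sinh_u_pos (h : IsDispersion u w γ) : 0 < Real.sinh u := Real.sinh_pos_iff.mpr h.pos

theorem sinh_w_pos (h : IsDispersion u w γ) : 0 < Real.sinh w :=
  Real.sinh_pos_iff.mpr (h.pos.trans h.lt)

theorem symb_re_pos (h : IsDispersion u w γ) (θ : ℝ) : 0 < (symb u w θ).re := by
  have h1 : 0 < Real.sinh (w - u) := Real.sinh_pos_iff.mpr (sub_pos.mpr h.lt)
  rw [Real.sinh_sub] at h1
  rw [symb_re]
  nlinarith [mul_pos h.sinh_u_pos (Real.cosh_pos w), Real.cos_le_one θ]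

theorem gamma_congr (h : IsDispersion u w γ) {θ φ : ℝ} (hc : Real.cos θ = Real.cos φ) :
    γ θ = γ φ :=
  Real.cosh_injOn (h.nonneg θ) (h.nonneg φ) (by rw [h.cosh_eq, h.cosh_eq, hc])

theorem symb_mul_symb_neg (h : IsDispersion u w γ) (θ : ℝ) :
    symb u w θ * symb u w (-θ) = (Real.sinh (γ θ) : ℂ) ^ 2 := by
  rw [← conj_symb, Complex.mul_conj, ← Complex.ofReal_pow, Complex.normSq_apply, symb_re, symb_im,
    Real.sinh_sq, h.cosh_eq]
  congr 1
  have h1 := Real.cosh_sq u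
  have h2 := Real.cosh_sq w
  have h3 := Real.sin_sq_add_cos_sq θ
  linear_combination Real.sinh u ^ 2 * h3 - h1 +
    (Real.sinh u ^ 2 * Real.cos θ ^ 2 - Real.cosh u ^ 2) * h2

theorem sinh_gamma_pos (h : IsDispersion u w γ) (θ : ℝ) : 0 < Real.sinh (γ θ) := by
  refine lt_of_le_of_ne (Real.sinh_nonneg_iff.mpr (h.nonneg θ)) fun h0 => ?_
  have h1 := h.symb_mul_symb_neg θ
  rw [← h0, ← conj_symb, Complex.ofReal_zero, zero_pow two_ne_zero, Complex.mul_conj,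
    Complex.ofReal_eq_zero, Complex.normSq_eq_zero] at h1
  have h2 := h.symb_re_pos θ
  simp [h1] at h2

theorem gamma_pos (h : IsDispersion u w γ) (θ : ℝ) : 0 < γ θ :=
  Real.sinh_pos_iff.mp (h.sinh_gamma_pos θ)

theorem continuous (h : IsDispersion u w γ) : Continuous γ := by
  have : γ = fun θ => Real.arcosh (Real.cosh u * Real.cosh w -
      Real.sinh u * Real.sinh w * Real.cos θ) := by
    funext θ
    rw [← h.cosh_eq, Real.arcosh_cosh (h.nonneg θ)]
  rw [this]
  refine Real.continuousOn_arcosh.comp_continuous (by fun_prop) fun θ => ?_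
  rw [← h.cosh_eq]
  exact Real.one_le_cosh _

theorem sinh_mul_sinh (h : IsDispersion u w γ) (θ φ : ℝ) :
    Real.sinh ((γ θ + γ φ) / 2) * Real.sinh ((γ θ - γ φ) / 2) =
      Real.sinh u * Real.sinh w / 2 * (Real.cos φ - Real.cos θ) := by
  rw [sinh_half_add_mul_sinh_half_sub, h.cosh_eq, h.cosh_eq]
  ring

theorem gamma_zero (h : IsDispersion u w γ) : γ 0 = w - u := by
  refine Real.cosh_injOn (h.nonneg 0) (sub_nonneg.mpr h.lt.le) ?_
  rw [h.cosh_eq, Real.cosh_sub, Real.cos_zero]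
  ring

theorem gamma_pi (h : IsDispersion u w γ) : γ Real.pi = w + u := by
  refine Real.cosh_injOn (h.nonneg _) (add_pos (h.pos.trans h.lt) h.pos).le ?_
  rw [h.cosh_eq, Real.cosh_add, Real.cos_pi]
  ring

theorem sinh_zero_mul_sinh_pi (h : IsDispersion u w γ) (θ : ℝ) :
    Real.sinh ((γ θ + γ 0) / 2) * Real.sinh ((γ θ + γ Real.pi) / 2) =
      Real.sinh w / 2 * (Real.sinh (γ θ) + (symb u w θ).re) := by
  have h1 := sinh_half_add_mul_sinh_half_sub (γ θ + w) u
  have h2 := Real.cosh_sq w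
  rw [Real.cosh_add, h.cosh_eq] at h1
  rw [h.gamma_zero, h.gamma_pi, symb_re, ← add_sub_assoc, ← add_assoc, mul_comm, h1]
  linear_combination Real.cosh u / 2 * h2

end IsDispersion

/-- The unimodular number `b_θ` in terms of `symb` and `γ`. -/
def phase (u w : ℝ) (γ : ℝ → ℝ) (θ : ℝ) : ℂ := symb u w θ / Real.sinh (γ θ)

theorem cpow_inv_two_eq {x r : ℂ} (hr : 0 < r.re) (hx : r ^ 2 = x) : x ^ (2 : ℂ)⁻¹ = r := by
  have h1 : (x ^ (2 : ℂ)⁻¹) ^ 2 = r ^ 2 := by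
    rw [hx]
    exact_mod_cast Complex.cpow_nat_inv_pow x two_ne_zero
  rcases sq_eq_sq_iff_eq_or_eq_neg.mp h1 with h2 | h2
  · exact h2
  · have h3 : 0 ≤ (x ^ (2 : ℂ)⁻¹).re := by
      rw [Complex.cpow_inv_two_re]
      positivity
    rw [h2, Complex.neg_re] at h3
    linarith

namespace IsDispersion

variable {u w : ℝ} {γ : ℝ → ℝ}

theorem phase_re_pos (h : IsDispersion u w γ) (θ : ℝ) : 0 < (phase u w γ θ).re := by
  rw [phase, Complex.div_ofReal_re]
  exact div_pos (h.symb_re_pos θ) (h.sinh_gamma_pos θ)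

theorem phase_ne_zero (h : IsDispersion u w γ) (θ : ℝ) : phase u w γ θ ≠ 0 := fun h0 => by
  simpa [h0] using h.phase_re_pos θ

theorem continuous_phase (h : IsDispersion u w γ) : Continuous (phase u w γ) := by
  have h1 := h.continuous
  have h2 := continuous_symb u w
  unfold phase
  refine h2.div (by fun_prop) fun θ => ?_
  exact_mod_cast (h.sinh_gamma_pos θ).ne'

theorem phase_mul_phase_neg (h : IsDispersion u w γ) (θ : ℝ) :
    phase u w γ θ * phase u w γ (-θ) = 1 := by
  have h1 : (Real.sinh (γ θ) : ℂ) ≠ 0 := by exact_mod_cast (h.sinh_gamma_pos θ).ne'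
  rw [phase, phase, h.gamma_congr (Real.cos_neg θ), div_mul_div_comm, h.symb_mul_symb_neg]
  field_simp

theorem phase_neg (h : IsDispersion u w γ) (θ : ℝ) : phase u w γ (-θ) = (phase u w γ θ)⁻¹ :=
  (inv_eq_of_mul_eq_one_right (h.phase_mul_phase_neg θ)).symm

theorem conj_phase (h : IsDispersion u w γ) (θ : ℝ) :
    (starRingEnd ℂ) (phase u w γ θ) = (phase u w γ θ)⁻¹ := by
  rw [← h.phase_neg, phase, phase, map_div₀, conj_symb, Complex.conj_ofReal,
    h.gamma_congr (Real.cos_neg θ)]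

theorem norm_phase (h : IsDispersion u w γ) (θ : ℝ) : ‖phase u w γ θ‖ = 1 := by
  have h1 : (‖phase u w γ θ‖ : ℂ) ^ 2 = 1 := by
    rw [← Complex.mul_conj', h.conj_phase, mul_inv_cancel₀ (h.phase_ne_zero θ)]
  have h2 : ‖phase u w γ θ‖ ^ 2 = 1 := by exact_mod_cast h1
  exact (pow_eq_one_iff_of_nonneg (norm_nonneg _) two_ne_zero).mp h2

end IsDispersion

theorem bfun_eq_phase {Kxs Ky α β : ℝ} {γ : ℝ → ℝ} (h : IsDispersion (2 * Kxs) (2 * Ky) γ)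
    (hα : α = Real.tanh Kxs * (Real.cosh Ky / Real.sinh Ky))
    (hβ : β = Real.tanh Kxs * Real.tanh Ky) (θ : ℝ) :
    bfun α β θ = phase (2 * Kxs) (2 * Ky) γ θ := by
  have hKy : 0 < Ky := by linarith [h.pos, h.lt]
  have hs : Real.sinh Ky ≠ 0 := (Real.sinh_pos_iff.mpr hKy).ne'
  have hc : Real.cosh Ky ≠ 0 := (Real.cosh_pos Ky).ne'
  have hc' : Real.cosh Kxs ≠ 0 := (Real.cosh_pos Kxs).ne'
  have e1 := Real.cosh_sq Ky
  have e2 := Real.cosh_sq Kxs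
  set κ : ℝ := (Real.cosh Kxs ^ 2 * Real.sinh (2 * Ky))⁻¹ with hκ
  have hκ0 : κ ≠ 0 := inv_ne_zero (mul_ne_zero (pow_ne_zero 2 hc') h.sinh_w_pos.ne')
  have r1 : 1 + α * β = κ * (Real.cosh (2 * Kxs) * Real.sinh (2 * Ky)) := by
    rw [hα, hβ, hκ, Real.tanh_eq_sinh_div_cosh, Real.tanh_eq_sinh_div_cosh, Real.cosh_two_mul,
      Real.sinh_two_mul]
    field_simp
  have r2 : α + β = κ * (Real.sinh (2 * Kxs) * Real.cosh (2 * Ky)) := by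
    rw [hα, hβ, hκ, Real.tanh_eq_sinh_div_cosh, Real.tanh_eq_sinh_div_cosh, Real.cosh_two_mul,
      Real.sinh_two_mul, Real.sinh_two_mul]
    field_simp
  have r3 : α - β = κ * Real.sinh (2 * Kxs) := by
    rw [hα, hβ, hκ, Real.tanh_eq_sinh_div_cosh, Real.tanh_eq_sinh_div_cosh,
      Real.sinh_two_mul, Real.sinh_two_mul]
    field_simp
    linear_combination Real.sinh Kxs * e1
  have c1 : (1 : ℂ) + α * β = κ * (Real.cosh (2 * Kxs) * Real.sinh (2 * Ky)) := by
    exact_mod_cast r1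
  have c2 : (α : ℂ) + β = κ * (Real.sinh (2 * Kxs) * Real.cosh (2 * Ky)) := by exact_mod_cast r2
  have c3 : (α : ℂ) - β = κ * Real.sinh (2 * Kxs) := by exact_mod_cast r3
  have c4 : (Real.sin θ : ℂ) ^ 2 + (Real.cos θ : ℂ) ^ 2 = 1 := by
    exact_mod_cast Real.sin_sq_add_cos_sq θ
  have hE : Complex.exp (Complex.I * θ) = Real.cos θ + Real.sin θ * Complex.I := by
    rw [mul_comm, Complex.exp_mul_I, Complex.ofReal_cos, Complex.ofReal_sin]
  have hE' : Complex.exp (-Complex.I * θ) = Real.cos θ - Real.sin θ * Complex.I := by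
    rw [show -Complex.I * (θ : ℂ) = (-θ : ℂ) * Complex.I by ring, Complex.exp_mul_I,
      Complex.cos_neg, Complex.sin_neg, Complex.ofReal_cos, Complex.ofReal_sin]
    ring
  have n1 : (1 - α * Complex.exp (Complex.I * θ)) * (1 - β * Complex.exp (-Complex.I * θ)) =
      κ * symb (2 * Kxs) (2 * Ky) θ := by
    rw [hE, hE', symb]
    push_cast only [Complex.ofReal_sub, Complex.ofReal_mul]
    linear_combination c1 - (Real.cos θ : ℂ) * c2 - Complex.I * Real.sin θ * c3 + α * β * c4
      - α * β * Real.sin θ ^ 2 * Complex.I_sq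
  have n2 : (1 - β * Complex.exp (Complex.I * θ)) * (1 - α * Complex.exp (-Complex.I * θ)) =
      κ * symb (2 * Kxs) (2 * Ky) (-θ) := by
    rw [hE, hE', symb, Real.cos_neg, Real.sin_neg]
    push_cast only [Complex.ofReal_sub, Complex.ofReal_mul, Complex.ofReal_neg]
    linear_combination c1 - (Real.cos θ : ℂ) * c2 + Complex.I * Real.sin θ * c3 + α * β * c4
      - α * β * Real.sin θ ^ 2 * Complex.I_sq
  have hκ0' : (κ : ℂ) ≠ 0 := by exact_mod_cast hκ0
  have hy : (Real.sinh (γ θ) : ℂ) ≠ 0 := by exact_mod_cast (h.sinh_gamma_pos θ).ne'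
  refine cpow_inv_two_eq (h.phase_re_pos θ) ?_
  have hm := h.symb_mul_symb_neg θ
  have hsn : symb (2 * Kxs) (2 * Ky) (-θ) ≠ 0 := by
    intro h0
    rw [h0, mul_zero] at hm
    exact pow_ne_zero 2 hy hm.symm
  rw [n1, n2, phase, div_pow, ← hm]
  field_simp

theorem sqb_properties {Kxs Ky α β : ℝ} {γ : ℝ → ℝ} (h : IsDispersion (2 * Kxs) (2 * Ky) γ)
    (hα : α = Real.tanh Kxs * (Real.cosh Ky / Real.sinh Ky))
    (hβ : β = Real.tanh Kxs * Real.tanh Ky) (θ : ℝ) :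
    sqb α β θ ^ 2 = phase (2 * Kxs) (2 * Ky) γ θ ∧ 0 < (sqb α β θ).re ∧
      (starRingEnd ℂ) (sqb α β θ) = (sqb α β θ)⁻¹ := by
  rw [sqb, bfun_eq_phase h hα hβ]
  have h1 : (phase (2 * Kxs) (2 * Ky) γ θ ^ (2 : ℂ)⁻¹) ^ 2 = phase (2 * Kxs) (2 * Ky) γ θ := by
    exact_mod_cast Complex.cpow_nat_inv_pow (phase (2 * Kxs) (2 * Ky) γ θ) two_ne_zero
  refine ⟨h1, ?_, ?_⟩
  · rw [Complex.cpow_inv_two_re]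
    have := h.phase_re_pos θ
    positivity
  · have h2 : ‖phase (2 * Kxs) (2 * Ky) γ θ ^ (2 : ℂ)⁻¹‖ = 1 := by
      refine (pow_eq_one_iff_of_nonneg (norm_nonneg _) two_ne_zero).mp ?_
      rw [← norm_pow, h1, h.norm_phase]
    exact (Complex.inv_eq_conj h2).symm

/-- The periodic angles `2 k π / N`. -/
def pAngle (N k : ℕ) : ℝ := (2 * (k : ℝ)) * Real.pi / N

/-- The antiperiodic angles `(2 k + 1) π / N`. -/
def aAngle (N k : ℕ) : ℝ := (2 * (k : ℝ) + 1) * Real.pi / N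

theorem pAngle_reflect {N i k : ℕ} (hN : N ≠ 0) (h : i + k = N) :
    pAngle N i = -pAngle N k + 2 * Real.pi := by
  have hN' : (N : ℝ) ≠ 0 := Nat.cast_ne_zero.mpr hN
  have h' : (i : ℝ) + k = N := by exact_mod_cast h
  rw [pAngle, pAngle]
  field_simp
  linear_combination h'

theorem aAngle_reflect {N i k : ℕ} (hN : N ≠ 0) (h : i + k + 1 = N) :
    aAngle N i = -aAngle N k + 2 * Real.pi := by
  have hN' : (N : ℝ) ≠ 0 := Nat.cast_ne_zero.mpr hN
  have h' : (i : ℝ) + k + 1 = N := by exact_mod_cast h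
  rw [aAngle, aAngle]
  field_simp
  linear_combination 2 * h'

section Pairing

variable {R : Type*} [CommMonoid R] {F : ℝ → R}

theorem prod_aAngle_even (hF : Function.Periodic F (2 * Real.pi)) (m : ℕ) :
    ∏ j ∈ range (2 * m + 2), F (aAngle (2 * m + 2) j) =
      ∏ k ∈ range (m + 1), F (aAngle (2 * m + 2) k) * F (-aAngle (2 * m + 2) k) := by
  set N := 2 * m + 2 with hN
  rw [show range N = range ((m + 1) + (m + 1)) by congr 1; omega, prod_range_add,
    ← prod_range_reflect (fun k => F (aAngle N (m + 1 + k))), ← prod_mul_distrib]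
  refine prod_congr rfl fun k hk => ?_
  have hk := mem_range.mp hk
  rw [aAngle_reflect (i := m + 1 + (m + 1 - 1 - k)) (k := k) (by omega) (by omega), hF]

theorem prod_aAngle_odd (hF : Function.Periodic F (2 * Real.pi)) (m : ℕ) :
    (∏ j ∈ range (2 * m + 1), F (aAngle (2 * m + 1) j)) * F Real.pi =
      ∏ k ∈ range (m + 1), F (aAngle (2 * m + 1) k) * F (-aAngle (2 * m + 1) k) := by
  set N := 2 * m + 1 with hN
  have hpi : aAngle N m = Real.pi := by
    rw [aAngle, hN]; push_cast; field_simp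
  have hpi' : F (-aAngle N m) = F Real.pi := by
    rw [← hF, hpi]; congr 1; ring
  rw [show range N = range (m + 1 + m) by congr 1; omega, prod_range_add,
    ← prod_range_reflect (fun k => F (aAngle N (m + 1 + k))), prod_mul_distrib,
    prod_range_succ (fun k => F (-aAngle N k)), hpi', mul_assoc]
  congr 2
  refine prod_congr rfl fun k hk => ?_
  have hk := mem_range.mp hk
  rw [aAngle_reflect (k := k) (by omega) (by omega), hF]

theorem prod_pAngle_even (hF : Function.Periodic F (2 * Real.pi)) (m : ℕ) :
    ∏ j ∈ range (2 * m + 2), F (pAngle (2 * m + 2) j) = F 0 * F Real.pi *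
      ∏ k ∈ range m, F (pAngle (2 * m + 2) (k + 1)) * F (-pAngle (2 * m + 2) (k + 1)) := by
  set N := 2 * m + 2 with hN
  have hpi : pAngle N (m + 1) = Real.pi := by
    rw [pAngle, hN]; push_cast; field_simp
  rw [show range N = range (m + 1 + m + 1) by congr 1; omega, prod_range_succ', prod_range_add,
    ← prod_range_reflect (fun k => F (pAngle N (m + 1 + k + 1))), prod_mul_distrib,
    prod_range_succ, hpi, show pAngle N 0 = 0 by simp [pAngle]]
  have : ∏ k ∈ range m, F (pAngle N (m + 1 + (m - 1 - k) + 1)) =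
      ∏ k ∈ range m, F (-pAngle N (k + 1)) := by
    refine prod_congr rfl fun k hk => ?_
    have hk := mem_range.mp hk
    rw [pAngle_reflect (k := k + 1) (by omega) (by omega), hF]
  rw [this]
  ac_rfl

theorem prod_pAngle_odd (hF : Function.Periodic F (2 * Real.pi)) (m : ℕ) :
    ∏ j ∈ range (2 * m + 1), F (pAngle (2 * m + 1) j) = F 0 *
      ∏ k ∈ range m, F (pAngle (2 * m + 1) (k + 1)) * F (-pAngle (2 * m + 1) (k + 1)) := by
  set N := 2 * m + 1 with hN
  rw [show range N = range (m + m + 1) by congr 1; omega, prod_range_succ', prod_range_add,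
    ← prod_range_reflect (fun k => F (pAngle N (m + k + 1))), prod_mul_distrib,
    show pAngle N 0 = 0 by simp [pAngle]]
  have : ∏ k ∈ range m, F (pAngle N (m + (m - 1 - k) + 1)) =
      ∏ k ∈ range m, F (-pAngle N (k + 1)) := by
    refine prod_congr rfl fun k hk => ?_
    have hk := mem_range.mp hk
    rw [pAngle_reflect (k := k + 1) (by omega) (by omega), hF]
  rw [this]
  ac_rfl

/-- Pairing opposite momenta in the product over the antiperiodic set; the correction factor
accounts for `π` being its own opposite when `N` is odd. -/
theorem prod_thetaA_mul {N m : ℕ} (hm : N = 2 * m + 1 ∨ N = 2 * m + 2)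
    (hF : Function.Periodic F (2 * Real.pi)) :
    (∏ j : Fin N, F (thetaA N j)) * (if Even N then 1 else F Real.pi) =
      ∏ k ∈ range (m + 1), F (aAngle N k) * F (-aAngle N k) := by
  rw [show ∏ j : Fin N, F (thetaA N j) = ∏ j ∈ range N, F (aAngle N j) from
    Fin.prod_univ_eq_prod_range (fun j => F (aAngle N j)) N]
  rcases hm with rfl | rfl
  · rw [if_neg (by simp), prod_aAngle_odd hF m]
  · rw [if_pos ⟨m + 1, by omega⟩, mul_one, prod_aAngle_even hF m]

/-- Pairing opposite momenta in the product over the periodic set. -/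
theorem prod_thetaP_mul {N m : ℕ} (hm : N = 2 * m + 1 ∨ N = 2 * m + 2)
    (hF : Function.Periodic F (2 * Real.pi)) :
    (∏ j : Fin N, F (thetaP N j)) * (if Even N then 1 else F Real.pi) = F 0 * F Real.pi *
        ∏ k ∈ range m, F (pAngle N (k + 1)) * F (-pAngle N (k + 1)) := by
  rw [show ∏ j : Fin N, F (thetaP N j) = ∏ j ∈ range N, F (pAngle N j) from
    Fin.prod_univ_eq_prod_range (fun j => F (pAngle N j)) N]
  rcases hm with rfl | rfl
  · rw [if_neg (by simp), prod_pAngle_odd hF m]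
    ac_rfl
  · rw [if_pos ⟨m + 1, by omega⟩, mul_one, prod_pAngle_even hF m]

end Pairing

/-- Products of `sinh` half-sums along the dispersion curve are, up to a power of `z = e^{iθ}`,
of the form `c(z) + sinh σ · z d(z)` with polynomials `c` and `d`. -/
theorem exists_polynomial_prod_sinh (A B : ℝ) (g g' : ℕ → ℝ) (m : ℕ) :
    ∃ c d : Polynomial ℂ, c.natDegree ≤ 2 * m + 2 ∧ d.natDegree ≤ 2 * m ∧
      ∀ θ σ : ℝ, Real.cosh σ = A - B * Real.cos θ →
        Complex.exp (Complex.I * θ) ^ (m + 1) *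
            ((∏ k ∈ range (m + 1), Real.sinh ((σ + g k) / 2) * Real.sinh ((σ + g' k) / 2) : ℝ) : ℂ)
          = c.eval (Complex.exp (Complex.I * θ)) +
            Real.sinh σ * (Complex.exp (Complex.I * θ) * d.eval (Complex.exp (Complex.I * θ))) := by
  have hX : ∀ θ σ : ℝ, Real.cosh σ = A - B * Real.cos θ →
      Complex.exp (Complex.I * θ) * Real.cosh σ = A * Complex.exp (Complex.I * θ) -
        B / 2 * (Complex.exp (Complex.I * θ) ^ 2 + 1) := by
    intro θ σ h
    have h1 : Complex.exp (Complex.I * θ) * Complex.exp (-(Complex.I * θ)) = 1 := by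
      rw [← Complex.exp_add, add_neg_cancel, Complex.exp_zero]
    rw [h]
    push_cast
    rw [Complex.cos, show (θ : ℂ) * Complex.I = Complex.I * θ by ring,
      show -(θ : ℂ) * Complex.I = -(Complex.I * θ) by ring]
    linear_combination (-(B : ℂ) / 2) * h1
  have hfac : ∀ k (σ : ℝ), ((Real.sinh ((σ + g k) / 2) * Real.sinh ((σ + g' k) / 2) : ℝ) : ℂ) =
      (Real.cosh ((g k + g' k) / 2) / 2 : ℝ) * Real.cosh σ +
        (Real.sinh ((g k + g' k) / 2) / 2 : ℝ) * Real.sinh σ -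
          (Real.cosh ((g k - g' k) / 2) / 2 : ℝ) := by
    intro k σ
    have h1 := sinh_half_add_mul_sinh_half_sub (σ + (g k + g' k) / 2) ((g k - g' k) / 2)
    rw [show σ + (g k + g' k) / 2 + (g k - g' k) / 2 = σ + g k by ring,
      show σ + (g k + g' k) / 2 - (g k - g' k) / 2 = σ + g' k by ring, Real.cosh_add] at h1
    rw [h1, ← Complex.ofReal_mul, ← Complex.ofReal_mul, ← Complex.ofReal_add, ← Complex.ofReal_sub]
    congr 1
    ring
  set X : Polynomial ℂ := Polynomial.C (A : ℂ) * Polynomial.X -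
    Polynomial.C (B / 2 : ℂ) * (Polynomial.X ^ 2 + 1) with hXdef
  have hXdeg : X.natDegree ≤ 2 := by rw [hXdef]; compute_degree
  have hXeval : ∀ z, X.eval z = A * z - B / 2 * (z ^ 2 + 1) := by intro z; simp [hXdef]
  set L : ℕ → Polynomial ℂ := fun k => Polynomial.C ((Real.cosh ((g k + g' k) / 2) / 2 : ℝ) : ℂ) * X
    - Polynomial.C ((Real.cosh ((g k - g' k) / 2) / 2 : ℝ) : ℂ) * Polynomial.X with hL
  have hLdeg : ∀ k, (L k).natDegree ≤ 2 := by
    intro k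
    refine (Polynomial.natDegree_sub_le _ _).trans (max_le ?_ ?_)
    · exact (Polynomial.natDegree_C_mul_le _ _).trans hXdeg
    · exact (Polynomial.natDegree_C_mul_le _ _).trans (by simp)
  induction m with
  | zero =>
    refine ⟨L 0, Polynomial.C ((Real.sinh ((g 0 + g' 0) / 2) / 2 : ℝ) : ℂ), hLdeg 0, by simp, ?_⟩
    intro θ σ h
    rw [zero_add, prod_range_one, hfac, hL]
    simp only [Polynomial.eval_sub, Polynomial.eval_mul, Polynomial.eval_C, Polynomial.eval_X,
      hXeval, ← hX θ σ h]
    ring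
  | succ m ih =>
    obtain ⟨c, d, hc, hd, hcd⟩ := ih
    set S : ℂ := ((Real.sinh ((g (m + 1) + g' (m + 1)) / 2) / 2 : ℝ) : ℂ) with hS
    refine ⟨L (m + 1) * c + Polynomial.C S * (X ^ 2 - Polynomial.X ^ 2) * d,
      Polynomial.C S * c + L (m + 1) * d, ?_, ?_, ?_⟩
    · have h1 : (X ^ 2 - Polynomial.X ^ 2).natDegree ≤ 4 := by
        refine (Polynomial.natDegree_sub_le _ _).trans (max_le ?_ (by simp))
        exact Polynomial.natDegree_pow_le_of_le 2 hXdeg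
      have h2 : (Polynomial.C S * (X ^ 2 - Polynomial.X ^ 2)).natDegree ≤ 4 :=
        (Polynomial.natDegree_C_mul_le _ _).trans h1
      refine (Polynomial.natDegree_add_le _ _).trans (max_le ?_ ?_)
      · exact Polynomial.natDegree_mul_le.trans (by have := hLdeg (m + 1); omega)
      · exact Polynomial.natDegree_mul_le.trans (by omega)
    · refine (Polynomial.natDegree_add_le _ _).trans (max_le ?_ ?_)
      · exact (Polynomial.natDegree_C_mul_le _ _).trans (by omega)
      · exact Polynomial.natDegree_mul_le.trans (by have := hLdeg (m + 1); omega)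
    · intro θ σ h
      have h1 := hcd θ σ h
      have h2 := hX θ σ h
      have h3 : (Real.cosh σ : ℂ) ^ 2 = (Real.sinh σ : ℂ) ^ 2 + 1 := by
        exact_mod_cast Real.cosh_sq σ
      rw [prod_range_succ, Complex.ofReal_mul, hfac, pow_succ, mul_mul_mul_comm, h1, ← hS]
      simp only [hL, Polynomial.eval_add, Polynomial.eval_sub, Polynomial.eval_mul,
        Polynomial.eval_pow, Polynomial.eval_C, Polynomial.eval_X, hXeval, ← h2]
      linear_combination (-S * Complex.exp (Complex.I * θ) ^ 2 *
        d.eval (Complex.exp (Complex.I * θ))) * h3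

theorem exp_I_mul_thetaP_pow {N : ℕ} (hN : N ≠ 0) (j : Fin N) :
    Complex.exp (Complex.I * thetaP N j) ^ N = 1 := by
  have hN' : (N : ℂ) ≠ 0 := Nat.cast_ne_zero.mpr hN
  rw [← Complex.exp_nat_mul, Complex.exp_eq_one_iff]
  refine ⟨j, ?_⟩
  rw [thetaP]
  push_cast
  field_simp

theorem exp_I_mul_thetaA_pow {N : ℕ} (hN : N ≠ 0) (j : Fin N) :
    Complex.exp (Complex.I * thetaA N j) ^ N = -1 := by
  have hN' : (N : ℂ) ≠ 0 := Nat.cast_ne_zero.mpr hN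
  have h1 : (N : ℂ) * (Complex.I * thetaA N j) =
      Real.pi * Complex.I + ((j : ℕ) : ℤ) * (2 * Real.pi * Complex.I) := by
    rw [thetaA]
    push_cast
    field_simp
    ring
  rw [← Complex.exp_nat_mul, h1, Complex.exp_add, Complex.exp_int_mul_two_pi_mul_I,
    Complex.exp_pi_mul_I, mul_one]

theorem exp_I_mul_shift_injective {N : ℕ} (hN : N ≠ 0) (t : ℝ) :
    Function.Injective fun j : Fin N => Complex.exp (Complex.I * ((t + thetaP N j : ℝ) : ℂ)) := by
  intro j k hjk
  obtain ⟨n, hn⟩ := Complex.exp_eq_exp_iff_exists_int.mp hjk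
  have hN' : (N : ℂ) ≠ 0 := Nat.cast_ne_zero.mpr hN
  have h1 : ((j : ℕ) : ℂ) = (k : ℕ) + n * N := by
    have hpi : (Real.pi : ℂ) ≠ 0 := by exact_mod_cast Real.pi_ne_zero
    simp only [thetaP] at hn
    push_cast at hn
    field_simp at hn
    refine mul_left_cancel₀ (mul_ne_zero two_ne_zero hpi) ?_
    linear_combination hn
  have h2 : ((j : ℕ) : ℤ) = (k : ℕ) + n * N := by exact_mod_cast h1
  have hj := j.isLt
  have hk := k.isLt
  have h3 : n = 0 := by
    by_contra h0
    rcases lt_or_gt_of_ne h0 with h | h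
    · nlinarith
    · nlinarith
  rw [h3] at h2
  ext
  omega

theorem exp_I_mul_thetaP_injective {N : ℕ} (hN : N ≠ 0) :
    Function.Injective fun j : Fin N => Complex.exp (Complex.I * thetaP N j) := by
  simpa using exp_I_mul_shift_injective hN 0

theorem exp_I_mul_thetaA_injective {N : ℕ} (hN : N ≠ 0) :
    Function.Injective fun j : Fin N => Complex.exp (Complex.I * thetaA N j) := by
  have h1 := exp_I_mul_shift_injective hN (Real.pi / N)
  have h2 : ∀ j : Fin N, Real.pi / N + thetaP N j = thetaA N j := fun j => by
    rw [thetaP, thetaA]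
    ring
  simpa only [h2] using h1

theorem exp_thetaP_ne_exp_thetaA {N : ℕ} (hN : N ≠ 0) (j k : Fin N) :
    Complex.exp (Complex.I * thetaP N j) ≠ Complex.exp (Complex.I * thetaA N k) := fun h0 => by
  have h1 := exp_I_mul_thetaP_pow hN j
  rw [h0, exp_I_mul_thetaA_pow hN k] at h1
  norm_num at h1

theorem periodic_sub_exp_I (z : ℂ) :
    Function.Periodic (fun φ : ℝ => z - Complex.exp (Complex.I * φ)) (2 * Real.pi) := fun φ => by
  simp only
  congr 1
  rw [Complex.exp_eq_exp_iff_exists_int]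
  exact ⟨1, by push_cast; ring⟩

/-- The factor `1` or `z + 1`, according to the parity of `N`. -/
def parityFactor (N : ℕ) (z : ℂ) : ℂ := if Even N then 1 else z + 1

theorem prod_sub_exp_aAngle {N m : ℕ} (hm : N = 2 * m + 1 ∨ N = 2 * m + 2) (z : ℂ) :
    ∏ k ∈ range (m + 1), (z - Complex.exp (Complex.I * aAngle N k)) *
      (z - Complex.exp (Complex.I * (-aAngle N k : ℝ))) = (z ^ N + 1) * parityFactor N z := by
  have hN : N ≠ 0 := by omega
  have h1 := nodal_eq_X_pow_sub_C hN (exp_I_mul_thetaA_injective hN) (exp_I_mul_thetaA_pow hN)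
  have h2 := congrArg (Polynomial.eval z) h1
  rw [Lagrange.eval_nodal] at h2
  rw [← prod_thetaA_mul hm (periodic_sub_exp_I z), h2, parityFactor]
  simp [mul_comm Complex.I (Real.pi : ℂ), Complex.exp_pi_mul_I]

theorem prod_sub_exp_pAngle {N m : ℕ} (hm : N = 2 * m + 1 ∨ N = 2 * m + 2) (z : ℂ) :
    (z - 1) * (z + 1) * ∏ k ∈ range m, (z - Complex.exp (Complex.I * pAngle N (k + 1))) *
      (z - Complex.exp (Complex.I * (-pAngle N (k + 1) : ℝ))) =
        (z ^ N - 1) * parityFactor N z := by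
  have hN : N ≠ 0 := by omega
  have h1 := nodal_eq_X_pow_sub_C hN (exp_I_mul_thetaP_injective hN) (exp_I_mul_thetaP_pow hN)
  have h2 := congrArg (Polynomial.eval z) h1
  rw [Lagrange.eval_nodal] at h2
  have h3 := prod_thetaP_mul hm (periodic_sub_exp_I z)
  rw [h2] at h3
  simp only [Polynomial.eval_sub, Polynomial.eval_pow, Polynomial.eval_X, Polynomial.eval_C,
    Complex.ofReal_zero, mul_zero, Complex.exp_zero, mul_comm Complex.I (Real.pi : ℂ),
    Complex.exp_pi_mul_I, sub_neg_eq_add] at h3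
  rw [parityFactor, h3]

/-- Half of the momentum product over the periodic set, with the self-paired momenta removed. -/
def halfP (N m : ℕ) (γ : ℝ → ℝ) (σ : ℝ) : ℝ :=
  ∏ k ∈ range m, Real.sinh ((σ + γ (pAngle N (k + 1))) / 2)

/-- Half of the momentum product over the antiperiodic set. -/
def halfA (N m : ℕ) (γ : ℝ → ℝ) (σ : ℝ) : ℝ :=
  ∏ k ∈ range (m + 1), Real.sinh ((σ + γ (aAngle N k)) / 2)

theorem prod_sinh_sub_aAngle (N m : ℕ) (γ : ℝ → ℝ) (σ : ℝ) :
    ∏ k ∈ range (m + 1), Real.sinh ((σ - γ (aAngle N k)) / 2) =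
      (-1) ^ (m + 1) * halfA N m γ (-σ) := by
  have h1 := prod_const (s := range (m + 1)) (-1 : ℝ)
  rw [card_range] at h1
  rw [halfA, ← h1, ← prod_mul_distrib]
  refine prod_congr rfl fun k _ => ?_
  rw [neg_one_mul, ← Real.sinh_neg]
  ring_nf

theorem exp_mul_cos_sub_cos (θ φ : ℝ) :
    Complex.exp (Complex.I * θ) * ((2 * (Real.cos θ - Real.cos φ) : ℝ) : ℂ) =
      (Complex.exp (Complex.I * θ) - Complex.exp (Complex.I * φ)) *
        (Complex.exp (Complex.I * θ) - Complex.exp (Complex.I * (-φ : ℝ))) := by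
  have h1 : Complex.exp (Complex.I * φ) * Complex.exp (Complex.I * (-φ : ℝ)) = 1 := by
    rw [← Complex.exp_add]
    simp
  have h2 : Complex.exp (Complex.I * θ) * Complex.exp (Complex.I * (-θ : ℝ)) = 1 := by
    rw [← Complex.exp_add]
    simp
  push_cast at *
  have h3 := Complex.two_cos (θ : ℂ)
  have h4 := Complex.two_cos (φ : ℂ)
  simp only [mul_comm _ Complex.I] at h3 h4
  simp only [mul_neg] at *
  rw [mul_sub, h3, h4]
  linear_combination h2 - h1

namespace IsDispersion

variable {u w : ℝ} {γ : ℝ → ℝ} {N m : ℕ}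

theorem halfA_pos (h : IsDispersion u w γ) (θ : ℝ) : 0 < halfA N m γ (γ θ) :=
  prod_pos fun k _ => Real.sinh_pos_iff.mpr (by linarith [h.gamma_pos θ, h.gamma_pos (aAngle N k)])

theorem halfP_pos (h : IsDispersion u w γ) (θ : ℝ) : 0 < halfP N m γ (γ θ) :=
  prod_pos fun k _ =>
    Real.sinh_pos_iff.mpr (by linarith [h.gamma_pos θ, h.gamma_pos (pAngle N (k + 1))])

theorem exp_pow_mul_halfA (h : IsDispersion u w γ) (hm : N = 2 * m + 1 ∨ N = 2 * m + 2) (θ : ℝ) :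
    Complex.exp (Complex.I * θ) ^ (m + 1) * (halfA N m γ (γ θ) * halfA N m γ (-γ θ) : ℝ) =
      (Real.sinh u * Real.sinh w / 4 : ℝ) ^ (m + 1) *
        ((Complex.exp (Complex.I * θ) ^ N + 1) * parityFactor N (Complex.exp (Complex.I * θ))) := by
  rw [← prod_sub_exp_aAngle hm]
  have hpow (c : ℂ) : c ^ (m + 1) = ∏ _k ∈ range (m + 1), c := by simp
  rw [hpow, hpow, halfA, halfA]
  push_cast
  rw [← prod_mul_distrib, ← prod_mul_distrib, ← prod_mul_distrib]
  refine prod_congr rfl fun k _ => ?_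
  have h1 := h.sinh_mul_sinh θ (aAngle N k)
  have h2 := exp_mul_cos_sub_cos θ (aAngle N k)
  have h3 : Real.sinh ((-γ θ + γ (aAngle N k)) / 2) =
      -Real.sinh ((γ θ - γ (aAngle N k)) / 2) := by
    rw [← Real.sinh_neg]
    ring_nf
  have h4 : Real.sinh ((γ θ + γ (aAngle N k)) / 2) * Real.sinh ((-γ θ + γ (aAngle N k)) / 2) =
      Real.sinh u * Real.sinh w / 4 * (2 * (Real.cos θ - Real.cos (aAngle N k))) := by
    rw [h3]
    linear_combination -h1
  have h5 := congrArg (fun r : ℝ => (r : ℂ)) h4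
  push_cast at h2 h5 ⊢
  rw [← h2]
  linear_combination Complex.exp (Complex.I * θ) * h5

theorem exp_pow_mul_halfP (h : IsDispersion u w γ) (hm : N = 2 * m + 1 ∨ N = 2 * m + 2) (θ : ℝ) :
    Complex.exp (Complex.I * θ) ^ (m + 1) * (halfP N m γ (γ θ) * halfP N m γ (-γ θ) : ℝ) *
        (2 * Complex.I * Real.sin θ) =
      (Real.sinh u * Real.sinh w / 4 : ℝ) ^ m *
        ((Complex.exp (Complex.I * θ) ^ N - 1) * parityFactor N (Complex.exp (Complex.I * θ))) := by
  have h0 : Complex.exp (Complex.I * θ) * (2 * Complex.I * Real.sin θ) =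
      (Complex.exp (Complex.I * θ) - 1) * (Complex.exp (Complex.I * θ) + 1) := by
    rw [mul_comm Complex.I, Complex.exp_mul_I]
    push_cast
    linear_combination Complex.sin θ ^ 2 * Complex.I_sq - Complex.cos_sq_add_sin_sq θ
  have hprod : Complex.exp (Complex.I * θ) ^ m * (halfP N m γ (γ θ) * halfP N m γ (-γ θ) : ℝ) =
      (Real.sinh u * Real.sinh w / 4 : ℝ) ^ m *
        ∏ k ∈ range m, (Complex.exp (Complex.I * θ) - Complex.exp (Complex.I * pAngle N (k + 1))) *
          (Complex.exp (Complex.I * θ) - Complex.exp (Complex.I * (-pAngle N (k + 1) : ℝ))) := by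
    have hpow (c : ℂ) : c ^ m = ∏ _k ∈ range m, c := by simp
    rw [hpow, hpow, halfP, halfP]
    push_cast
    rw [← prod_mul_distrib, ← prod_mul_distrib, ← prod_mul_distrib]
    refine prod_congr rfl fun k _ => ?_
    have h1 := h.sinh_mul_sinh θ (pAngle N (k + 1))
    have h2 := exp_mul_cos_sub_cos θ (pAngle N (k + 1))
    have h3 : Real.sinh ((-γ θ + γ (pAngle N (k + 1))) / 2) =
        -Real.sinh ((γ θ - γ (pAngle N (k + 1))) / 2) := by
      rw [← Real.sinh_neg]
      ring_nf
    have h4 : Real.sinh ((γ θ + γ (pAngle N (k + 1))) / 2) *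
          Real.sinh ((-γ θ + γ (pAngle N (k + 1))) / 2) =
        Real.sinh u * Real.sinh w / 4 * (2 * (Real.cos θ - Real.cos (pAngle N (k + 1)))) := by
      rw [h3]
      linear_combination -h1
    have h5 := congrArg (fun r : ℝ => (r : ℂ)) h4
    push_cast at h2 h5 ⊢
    rw [← h2]
    linear_combination Complex.exp (Complex.I * θ) * h5
  rw [← prod_sub_exp_pAngle hm, ← h0]
  linear_combination Complex.exp (Complex.I * θ) * (2 * Complex.I * Real.sin θ) * hprod

end IsDispersion

/-- The values on the unit circle of the polynomial whose residues encode the matrix identity: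
the contributions of the two branches `±γ φ` of the dispersion relation. -/
def interpolantValue (u w : ℝ) (γ : ℝ → ℝ) (N m : ℕ) (g : ℝ) (β : ℂ) (φ : ℝ) : ℂ :=
  Complex.exp (Complex.I * φ) ^ (m + 1) *
    ((halfP N m γ (γ φ) * halfA N m γ (-γ φ) * Real.sinh ((γ φ - g) / 2) : ℝ) *
        ((phase u w γ φ + β) * (1 + (phase u w γ φ)⁻¹)) +
      (halfP N m γ (-γ φ) * halfA N m γ (γ φ) * Real.sinh ((-γ φ - g) / 2) : ℝ) *
        ((β - phase u w γ φ) * (1 - (phase u w γ φ)⁻¹)))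

namespace IsDispersion

variable {u w : ℝ} {γ : ℝ → ℝ} {N m : ℕ}

theorem phase_eq_one (h : IsDispersion u w γ) {θ : ℝ} (hθ : Real.sin θ = 0) :
    phase u w γ θ = 1 := by
  have h1 := symb_neg_sub_symb u w θ
  rw [hθ, Complex.ofReal_zero, mul_zero, sub_eq_zero] at h1
  have h2 := h.phase_mul_phase_neg θ
  rw [phase, phase, h1, h.gamma_congr (Real.cos_neg θ), ← phase] at h2
  rcases mul_self_eq_one_iff.mp h2 with h3 | h3
  · exact h3
  · have h4 := h.phase_re_pos θ
    rw [h3] at h4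
    norm_num at h4

theorem sinh_mul_phase (h : IsDispersion u w γ) (θ : ℝ) :
    Real.sinh (γ θ) * phase u w γ θ = symb u w θ :=
  mul_div_cancel₀ _ (by exact_mod_cast (h.sinh_gamma_pos θ).ne')

theorem sinh_mul_phase_inv (h : IsDispersion u w γ) (θ : ℝ) :
    Real.sinh (γ θ) * (phase u w γ θ)⁻¹ = symb u w (-θ) := by
  rw [← h.phase_neg, ← h.gamma_congr (Real.cos_neg θ), h.sinh_mul_phase]

/-- The Laurent polynomial `symb`, times `z`, is a polynomial of degree at most two. -/
theorem exists_polynomial_symb (u w : ℝ) (β : ℂ) : ∃ p : Polynomial ℂ, p.natDegree ≤ 2 ∧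
    ∀ φ : ℝ, p.eval (Complex.exp (Complex.I * φ)) =
      Complex.exp (Complex.I * φ) * (symb u w φ + β * symb u w (-φ)) := by
  set A : ℂ := Real.cosh u * Real.sinh w
  set B : ℂ := Real.sinh u * Real.cosh w / 2
  set S : ℂ := Real.sinh u / 2
  refine ⟨Polynomial.C (-(1 + β) * B + (β - 1) * S) * Polynomial.X ^ 2 +
    Polynomial.C ((1 + β) * A) * Polynomial.X + Polynomial.C (-(1 + β) * B - (β - 1) * S),
    Polynomial.natDegree_quadratic_le, fun φ => ?_⟩
  have h1 : Complex.exp (Complex.I * φ) = Real.cos φ + Real.sin φ * Complex.I := by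
    rw [mul_comm, Complex.exp_mul_I]
    push_cast
    ring
  have h2 : (Real.cos φ : ℂ) ^ 2 + (Real.sin φ : ℂ) ^ 2 = 1 := by
    exact_mod_cast Real.cos_sq_add_sin_sq φ
  simp only [Polynomial.eval_add, Polynomial.eval_mul, Polynomial.eval_C, Polynomial.eval_pow,
    Polynomial.eval_X, symb, Real.cos_neg, Real.sin_neg]
  rw [h1]
  push_cast at h2 ⊢
  have hA : A = Complex.cosh u * Complex.sinh w := by simp [A]
  have hB : 2 * B = Complex.sinh u * Complex.cosh w := by simp [B]; ring
  have hS : 2 * S = Complex.sinh u := by simp [S]; ring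
  rw [← hA, ← hB, ← hS]
  linear_combination ((1 + β) * B + (β - 1) * S) * h2 -
    ((1 + β) * B + (β - 1) * S) * Complex.sin φ ^ 2 * Complex.I_sq

theorem exists_interpolant (h : IsDispersion u w γ) (g : ℝ) (β : ℂ) (N m : ℕ) :
    ∃ v : Polynomial ℂ, v.natDegree ≤ 2 * m + 2 ∧
      ∀ φ : ℝ, v.eval (Complex.exp (Complex.I * φ)) =
        interpolantValue u w γ N m g β φ := by
  obtain ⟨c, d, hc, hd, hcd⟩ := exists_polynomial_prod_sinh (Real.cosh u * Real.cosh w)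
    (Real.sinh u * Real.sinh w) (fun k => if k = 0 then -g else γ (pAngle N k))
    (fun k => -γ (aAngle N k)) m
  obtain ⟨p, hp, hpe⟩ := exists_polynomial_symb u w β
  have hprod (σ : ℝ) : (∏ k ∈ range (m + 1),
      Real.sinh ((σ + if k = 0 then -g else γ (pAngle N k)) / 2) *
        Real.sinh ((σ + -γ (aAngle N k)) / 2)) =
      (-1) ^ (m + 1) * (halfP N m γ σ * halfA N m γ (-σ) * Real.sinh ((σ - g) / 2)) := by
    rw [prod_mul_distrib, prod_range_succ']
    simp only [← sub_eq_add_neg, if_true, Nat.add_eq_zero_iff, one_ne_zero, and_false, if_false]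
    rw [prod_sinh_sub_aAngle, halfP]
    ring
  have hsq : ((-1 : ℂ) ^ (m + 1)) * (-1) ^ (m + 1) = 1 := by
    rw [← mul_pow]
    norm_num
  refine ⟨Polynomial.C ((-1) ^ (m + 1) * 2) * (Polynomial.C (1 + β) * c + p * d), ?_, fun φ => ?_⟩
  · refine (Polynomial.natDegree_C_mul_le _ _).trans (Polynomial.natDegree_add_le_of_degree_le
      ((Polynomial.natDegree_C_mul_le _ _).trans hc) ?_)
    exact Polynomial.natDegree_mul_le.trans (by omega)
  · have h1 := hcd φ (γ φ) (h.cosh_eq φ)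
    have h2 := hcd φ (-γ φ) (by rw [Real.cosh_neg, h.cosh_eq])
    have h3 := h.sinh_mul_phase φ
    have h4 := h.sinh_mul_phase_inv φ
    have h5 : phase u w γ φ * (phase u w γ φ)⁻¹ = 1 := mul_inv_cancel₀ (h.phase_ne_zero φ)
    rw [hprod] at h1 h2
    rw [neg_neg, Real.sinh_neg] at h2
    simp only [Polynomial.eval_add, Polynomial.eval_mul, Polynomial.eval_C, hpe, ← h3, ← h4,
      interpolantValue]
    generalize phase u w γ φ = b at *
    generalize b⁻¹ = b' at *
    generalize halfP N m γ (γ φ) * halfA N m γ (-γ φ) * Real.sinh ((γ φ - g) / 2) = Q1 at *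
    generalize halfP N m γ (-γ φ) * halfA N m γ (γ φ) * Real.sinh ((-γ φ - g) / 2) = Q2 at *
    generalize Complex.exp (Complex.I * φ) = z at *
    generalize Polynomial.eval z c = cz at *
    generalize Polynomial.eval z d = dz at *
    push_cast at *
    generalize (-1 : ℂ) ^ (m + 1) = e at *
    generalize Complex.sinh (γ φ : ℂ) = y at *
    have h6 : z ^ (m + 1) * Q1 = e * (cz + y * (z * dz)) := by
      linear_combination e * h1 - z ^ (m + 1) * Q1 * hsq
    have h7 : z ^ (m + 1) * Q2 = e * (cz - y * (z * dz)) := by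
      linear_combination e * h2 - z ^ (m + 1) * Q2 * hsq
    linear_combination -(b + β) * (1 + b') * h6 - (β - b) * (1 - b') * h7 -
      e * (2 * cz) * h5

theorem exists_reduced_interpolant (h : IsDispersion u w γ) (g : ℝ) (β : ℂ)
    (hm : N = 2 * m + 1 ∨ N = 2 * m + 2) :
    ∃ v : Polynomial ℂ, v.natDegree ≤ N ∧
      ∀ φ : ℝ, parityFactor N (Complex.exp (Complex.I * φ)) *
          v.eval (Complex.exp (Complex.I * φ)) =
        interpolantValue u w γ N m g β φ := by
  obtain ⟨v, hv, hve⟩ := h.exists_interpolant g β N m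
  rcases hm with hm | hm
  · have hodd : ¬ Even N := by rw [hm]; simp
    have hpi : aAngle N m = Real.pi := by
      rw [aAngle, hm]; push_cast; field_simp
    have hroot : v.eval (-1) = 0 := by
      have h1 := hve Real.pi
      rw [mul_comm Complex.I, Complex.exp_pi_mul_I] at h1
      have h2 : halfA N m γ (-γ Real.pi) = 0 :=
        prod_eq_zero (self_mem_range_succ m) (by simp [hpi])
      rw [h1, interpolantValue, h2, h.phase_eq_one Real.sin_pi]
      simp
    obtain ⟨v1, hv1⟩ := Polynomial.dvd_iff_isRoot.mpr hroot
    refine ⟨v1, ?_, fun φ => ?_⟩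
    · rcases eq_or_ne v1 0 with h0 | h0
      · simp [h0]
      · rw [hv1, Polynomial.natDegree_mul (Polynomial.X_sub_C_ne_zero _) h0,
          Polynomial.natDegree_X_sub_C] at hv
        omega
    · rw [← hve, hv1, parityFactor, if_neg hodd]
      simp
  · have heven : Even N := ⟨m + 1, by omega⟩
    refine ⟨v, hm ▸ hv, fun φ => ?_⟩
    rw [← hve, parityFactor, if_pos heven, one_mul]

end IsDispersion

theorem parityFactor_ne_zero {N : ℕ} {z : ℂ} (hz : z ^ N ≠ -1) : parityFactor N z ≠ 0 := by
  unfold parityFactor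
  split_ifs with hN
  · exact one_ne_zero
  · intro h0
    rw [eq_neg_of_add_eq_zero_left h0, (Nat.not_even_iff_odd.mp hN).neg_one_pow] at hz
    exact hz rfl

theorem exp_pow_im (N : ℕ) (θ : ℝ) :
    (Complex.exp (Complex.I * θ) ^ N).im = Real.sin (N * θ) := by
  rw [← Complex.exp_nat_mul, ← Complex.exp_ofReal_mul_I_im]
  push_cast
  ring_nf

theorem exp_pow_ne_one {N : ℕ} {θ : ℝ} (hθ : Real.sin (N * θ) ≠ 0) :
    Complex.exp (Complex.I * θ) ^ N ≠ 1 := fun h0 => hθ (by rw [← exp_pow_im, h0, Complex.one_im])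

theorem exp_pow_ne_neg_one {N : ℕ} {θ : ℝ} (hθ : Real.sin (N * θ) ≠ 0) :
    Complex.exp (Complex.I * θ) ^ N ≠ -1 :=
  fun h0 => hθ (by rw [← exp_pow_im, h0, Complex.neg_im, Complex.one_im, neg_zero])

theorem sin_ne_zero_of_sin_nat_mul {N : ℕ} {θ : ℝ} (hθ : Real.sin (N * θ) ≠ 0) :
    Real.sin θ ≠ 0 := fun h0 => hθ (by
  obtain ⟨n, hn⟩ := Real.sin_eq_zero_iff.mp h0
  rw [← hn, ← mul_assoc]
  exact_mod_cast Real.sin_int_mul_pi (N * n))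

theorem exp_I_sub_exp_I (φ ψ : ℝ) :
    Complex.exp (Complex.I * φ) - Complex.exp (Complex.I * ψ) =
      Complex.exp (Complex.I * ((φ + ψ) / 2 : ℝ)) * (2 * Complex.I * Real.sin ((φ - ψ) / 2)) := by
  have h1 : Complex.exp (Complex.I * φ) = Complex.exp (Complex.I * ((φ + ψ) / 2 : ℝ)) *
      Complex.exp (((φ - ψ) / 2 : ℝ) * Complex.I) := by
    rw [← Complex.exp_add]
    congr 1
    push_cast
    ring
  have h2 : Complex.exp (Complex.I * ψ) = Complex.exp (Complex.I * ((φ + ψ) / 2 : ℝ)) *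
      Complex.exp (-((φ - ψ) / 2 : ℝ) * Complex.I) := by
    rw [← Complex.exp_add]
    congr 1
    push_cast
    ring
  have h3 := Complex.two_sin (((φ - ψ) / 2 : ℝ) : ℂ)
  rw [h1, h2]
  rw [Complex.ofReal_sin]
  linear_combination -Complex.exp (Complex.I * ((φ + ψ) / 2 : ℝ)) * Complex.I * h3 +
    Complex.exp (Complex.I * ((φ + ψ) / 2 : ℝ)) *
      (Complex.exp (((φ - ψ) / 2 : ℝ) * Complex.I) -
        Complex.exp (-((φ - ψ) / 2 : ℝ) * Complex.I)) * Complex.I_sq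

/-- The ratio of the two half products at momentum `θ`. -/
def halfRatio (N m : ℕ) (γ : ℝ → ℝ) (θ : ℝ) : ℝ :=
  halfP N m γ (γ θ) / halfA N m γ (γ θ)

/-- The summand of the residue identity at the periodic momentum `φ`. -/
def residueTerm (u w : ℝ) (γ : ℝ → ℝ) (N m : ℕ) (θ η φ : ℝ) : ℂ :=
  halfRatio N m γ φ * ((phase u w γ φ + phase u w γ η) * (1 + (phase u w γ φ)⁻¹)) *
    Real.sin ((θ - φ) / 2) / (Real.sinh ((γ φ + γ θ) / 2) * Real.sin ((φ - η) / 2))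

namespace IsDispersion

variable {u w : ℝ} {γ : ℝ → ℝ} {N m : ℕ}

theorem halfRatio_pos (h : IsDispersion u w γ) (θ : ℝ) : 0 < halfRatio N m γ θ :=
  div_pos (h.halfP_pos θ) (h.halfA_pos θ)

theorem sinh_half_add_pos (h : IsDispersion u w γ) (θ φ : ℝ) :
    0 < Real.sinh ((γ θ + γ φ) / 2) :=
  Real.sinh_pos_iff.mpr (by linarith [h.gamma_pos θ, h.gamma_pos φ])

theorem sinh_half_sub (h : IsDispersion u w γ) (θ φ : ℝ) :
    Real.sinh ((γ φ - γ θ) / 2) = -(Real.sinh u * Real.sinh w) * Real.sin ((θ + φ) / 2) *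
      Real.sin ((θ - φ) / 2) / Real.sinh ((γ φ + γ θ) / 2) := by
  rw [eq_div_iff (h.sinh_half_add_pos φ θ).ne', mul_comm, h.sinh_mul_sinh, Real.cos_sub_cos]
  ring

/-- The lower branch vanishes at the periodic momenta. -/
theorem lower_branch_thetaP (h : IsDispersion u w γ) (hm : N = 2 * m + 1 ∨ N = 2 * m + 2)
    (j : Fin N) :
    (halfP N m γ (-γ (thetaP N j)) : ℂ) * (1 - (phase u w γ (thetaP N j))⁻¹) = 0 := by
  have hN : N ≠ 0 := by omega
  by_cases hs : Real.sin (thetaP N j) = 0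
  · rw [h.phase_eq_one hs, inv_one, sub_self, mul_zero]
  · have h1 := h.exp_pow_mul_halfP hm (thetaP N j)
    rw [exp_I_mul_thetaP_pow hN, sub_self, zero_mul, mul_zero] at h1
    have h2 : (Real.sin (thetaP N j) : ℂ) ≠ 0 := by exact_mod_cast hs
    have h3 : (halfP N m γ (γ (thetaP N j)) : ℂ) ≠ 0 := by
      exact_mod_cast (h.halfP_pos (thetaP N j)).ne'
    have h4 : (halfP N m γ (-γ (thetaP N j)) : ℂ) = 0 := by
      push_cast at h1 h2
      simpa [Complex.exp_ne_zero, h2, h3, Complex.I_ne_zero] using h1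
    rw [h4, zero_mul]

end IsDispersion

namespace IsDispersion

variable {u w : ℝ} {γ : ℝ → ℝ} {N m : ℕ}

theorem eval_of_lower_branch_eq_zero (h : IsDispersion u w γ)
    (hm : N = 2 * m + 1 ∨ N = 2 * m + 2) {g : ℝ} {β V : ℂ} {φ : ℝ}
    (hV : parityFactor N (Complex.exp (Complex.I * φ)) * V = interpolantValue u w γ N m g β φ)
    (hφ : Complex.exp (Complex.I * φ) ^ N ≠ -1)
    (h0 : (halfP N m γ (-γ φ) : ℂ) * ((β - phase u w γ φ) * (1 - (phase u w γ φ)⁻¹)) = 0) :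
    V = (Real.sinh u * Real.sinh w / 4 : ℝ) ^ (m + 1) *
      (Complex.exp (Complex.I * φ) ^ N + 1) * halfRatio N m γ φ * Real.sinh ((γ φ - g) / 2) *
        ((phase u w γ φ + β) * (1 + (phase u w γ φ)⁻¹)) := by
  have h1 := h.exp_pow_mul_halfA hm φ
  have hA : (halfA N m γ (γ φ) : ℂ) ≠ 0 := by exact_mod_cast (h.halfA_pos φ).ne'
  have hs := parityFactor_ne_zero hφ
  have h2 : (halfRatio N m γ φ : ℂ) * halfA N m γ (γ φ) = halfP N m γ (γ φ) := by
    rw [halfRatio, Complex.ofReal_div, div_mul_cancel₀ _ hA]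
  refine mul_left_cancel₀ (mul_ne_zero hs hA) ?_
  rw [interpolantValue] at hV
  generalize (phase u w γ φ + β) * (1 + (phase u w γ φ)⁻¹) = T at *
  generalize (β - phase u w γ φ) * (1 - (phase u w γ φ)⁻¹) = T' at *
  generalize Complex.exp (Complex.I * φ) ^ (m + 1) = zm at *
  rw [Complex.ofReal_mul] at h1
  simp only [Complex.ofReal_mul] at hV
  linear_combination (halfA N m γ (γ φ) : ℂ) * hV +
    zm * (halfA N m γ (γ φ) : ℂ) ^ 2 * Real.sinh ((-γ φ - g) / 2) * h0 +
    halfP N m γ (γ φ) * Real.sinh ((γ φ - g) / 2) * T * h1 -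
    parityFactor N (Complex.exp (Complex.I * φ)) *
      (Real.sinh u * Real.sinh w / 4 : ℝ) ^ (m + 1) * (Complex.exp (Complex.I * φ) ^ N + 1) *
        Real.sinh ((γ φ - g) / 2) * T * h2

theorem one_add_phase_ne_zero (h : IsDispersion u w γ) (θ : ℝ) : 1 + phase u w γ θ ≠ 0 :=
  fun h0 => by
    have h1 := congrArg Complex.re h0
    have h2 := h.phase_re_pos θ
    rw [Complex.add_re, Complex.one_re, Complex.zero_re] at h1
    linarith

theorem eval_at_reflected (h : IsDispersion u w γ)
    (hm : N = 2 * m + 1 ∨ N = 2 * m + 2) {β V : ℂ} {θ : ℝ}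
    (hV : parityFactor N (Complex.exp (Complex.I * (-θ : ℝ))) * V =
      interpolantValue u w γ N m (γ θ) β (-θ))
    (hθ : Real.sin (N * θ) ≠ 0) :
    V / (Complex.exp (Complex.I * (-θ : ℝ)) ^ N - 1) =
      (Real.sinh u * Real.sinh w / 4 : ℝ) ^ m * Real.sinh u * (β * phase u w γ θ - 1) /
        ((1 + phase u w γ θ) * halfRatio N m γ θ) := by
  have hθ' : Real.sin (N * (-θ)) ≠ 0 := by
    rwa [mul_neg, Real.sin_neg, neg_ne_zero]
  have h1 := h.exp_pow_mul_halfP hm (-θ)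
  have hA : (halfA N m γ (γ θ) : ℂ) ≠ 0 := by exact_mod_cast (h.halfA_pos θ).ne'
  have hP : (halfP N m γ (γ θ) : ℂ) ≠ 0 := by exact_mod_cast (h.halfP_pos θ).ne'
  have hs := parityFactor_ne_zero (exp_pow_ne_neg_one hθ')
  have hsin : (Real.sin θ : ℂ) ≠ 0 := by exact_mod_cast sin_ne_zero_of_sin_nat_mul hθ
  have hb := h.one_add_phase_ne_zero θ
  have hb0 := h.phase_ne_zero θ
  have hden := sub_ne_zero.mpr (exp_pow_ne_one hθ')
  have h3 := h.sinh_mul_phase θ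
  have h4 := h.sinh_mul_phase_inv θ
  have h5 := symb_neg_sub_symb u w θ
  rw [← h3, ← h4] at h5
  have h6 : (-γ θ - γ θ) / 2 = -γ θ := by ring
  rw [interpolantValue, h.phase_neg, h.gamma_congr (Real.cos_neg θ), sub_self, zero_div,
    Real.sinh_zero, mul_zero, Complex.ofReal_zero, zero_mul, zero_add, inv_inv, h6,
    Real.sinh_neg] at hV
  rw [h.gamma_congr (Real.cos_neg θ), Real.sin_neg] at h1
  rw [halfRatio, div_eq_div_iff hden (mul_ne_zero hb (by
    rw [Complex.ofReal_div]
    exact div_ne_zero hP hA))]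
  generalize parityFactor N (Complex.exp (Complex.I * (-θ : ℝ))) = s at *
  generalize Complex.exp (Complex.I * (-θ : ℝ)) ^ (m + 1) = zm at *
  generalize Complex.exp (Complex.I * (-θ : ℝ)) ^ N = zN at *
  generalize phase u w γ θ = b at *
  simp only [Complex.ofReal_mul, Complex.ofReal_neg, Complex.ofReal_div] at *
  generalize (halfP N m γ (-γ θ) : ℂ) = P' at *
  generalize (halfP N m γ (γ θ) : ℂ) = P at *
  generalize (halfA N m γ (γ θ) : ℂ) = A at *
  generalize (Real.sinh u : ℂ) = S at *
  generalize (Real.sinh w : ℂ) = S' at *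
  generalize (Real.sinh (γ θ) : ℂ) = y at *
  generalize (Real.sin θ : ℂ) = σ at *
  field_simp at h5 ⊢
  refine mul_left_cancel₀ (mul_ne_zero (mul_ne_zero hs (mul_ne_zero two_ne_zero
    (mul_ne_zero Complex.I_ne_zero hsin))) hb0) ?_
  linear_combination 2 * Complex.I * σ * (1 + b) * P * b * hV +
    A * y * (β * b - 1) * (1 - b ^ 2) * h1 +
    (S * S' / (4 : ℝ)) ^ m * (zN - 1) * s * A * (β * b - 1) * h5 +
    2 * Complex.I * σ * (1 + b) * P * zm * P' * A * y * (1 - b) * (mul_inv_cancel₀ hb0)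

/-- The residue identity at generic angles. -/
theorem residue_identity (h : IsDispersion u w γ) (hm : N = 2 * m + 1 ∨ N = 2 * m + 2)
    {θ η : ℝ} (hθ : Real.sin (N * θ) ≠ 0) (hη : Real.sin (N * η) ≠ 0)
    (hθη : Real.sin ((θ + η) / 2) ≠ 0) :
    (Real.sinh u * Real.sinh w) ^ 2 / (8 * N) * ∑ j, residueTerm u w γ N m θ η (thetaP N j) -
      Real.sinh u * (phase u w γ η * phase u w γ θ - 1) /
        ((1 + phase u w γ θ) * halfRatio N m γ θ * (2 * Complex.I * Real.sin ((θ + η) / 2))) +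
      Real.sinh u * Real.sinh w / 4 * (Complex.exp (Complex.I * η) ^ N + 1) /
        (Complex.exp (Complex.I * η) ^ N - 1) * halfRatio N m γ η *
          Real.sinh ((γ η - γ θ) / 2) * (2 * (1 + phase u w γ η)) /
            (2 * Complex.I * Real.sin ((θ + η) / 2)) = 0 := by
  have hN : N ≠ 0 := by omega
  have hN' : (N : ℂ) ≠ 0 := Nat.cast_ne_zero.mpr hN
  have hθ' : Real.sin (N * (-θ)) ≠ 0 := by
    rwa [mul_neg, Real.sin_neg, neg_ne_zero]
  obtain ⟨v, hv, hve⟩ := h.exists_reduced_interpolant (N := N) (γ θ) (phase u w γ η) hm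
  set a := Complex.exp (Complex.I * (-θ : ℝ)) with ha
  set b := Complex.exp (Complex.I * η) with hb
  set e := Complex.exp (Complex.I * ((-θ + η) / 2 : ℝ)) with he
  have he0 : e ≠ 0 := Complex.exp_ne_zero _
  have hsin : (Real.sin ((θ + η) / 2) : ℂ) ≠ 0 := by exact_mod_cast hθη
  have hab : a - b = -(e * (2 * Complex.I * Real.sin ((θ + η) / 2))) := by
    rw [ha, hb, exp_I_sub_exp_I, show (-θ - η) / 2 = -((θ + η) / 2) by ring, Real.sin_neg, ← he,
      Complex.ofReal_neg]
    ring
  have hba : b - a = e * (2 * Complex.I * Real.sin ((θ + η) / 2)) := by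
    linear_combination -hab
  have hab0 : a ≠ b := by
    rw [← sub_ne_zero, hab]
    simp only [ne_eq, neg_eq_zero, mul_eq_zero, he0, hsin, Complex.I_ne_zero, two_ne_zero, or_self,
      not_false_eq_true]
  have haN := exp_pow_ne_one hθ'
  have hbN := exp_pow_ne_one hη
  have hsum := sum_residues_eq_zero hN (exp_I_mul_thetaP_injective hN) (exp_I_mul_thetaP_pow hN)
    hv haN hbN hab0
  set K : ℂ := (Real.sinh u * Real.sinh w / 4 : ℝ) ^ m with hK
  set k : ℂ := Real.sinh u * Real.sinh w / 4 with hk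
  have hk' : ((Real.sinh u * Real.sinh w / 4 : ℝ) : ℂ) = k := by
    rw [hk]
    push_cast
    ring
  have hK0 : K ≠ 0 := pow_ne_zero _ (by
    exact_mod_cast (div_pos (mul_pos h.sinh_u_pos h.sinh_w_pos) four_pos).ne')
  have hterm : ∀ j : Fin N, Complex.exp (Complex.I * thetaP N j) / N *
      v.eval (Complex.exp (Complex.I * thetaP N j)) /
        ((Complex.exp (Complex.I * thetaP N j) - a) * (Complex.exp (Complex.I * thetaP N j) - b)) =
      K / e * ((Real.sinh u * Real.sinh w) ^ 2 / (8 * N) *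
        residueTerm u w γ N m θ η (thetaP N j)) := by
    intro j
    have hx := exp_I_mul_thetaP_pow hN j
    have hv1 := h.eval_of_lower_branch_eq_zero hm (hve (thetaP N j)) (by rw [hx]; norm_num)
      (by rw [mul_left_comm, h.lower_branch_thetaP hm, mul_zero])
    have hxa : Complex.exp (Complex.I * thetaP N j) - a ≠ 0 := fun h0 => haN (by
      rw [← ha, ← sub_eq_zero.mp h0, hx])
    have hxb : Complex.exp (Complex.I * thetaP N j) - b ≠ 0 := fun h0 => hbN (by
      rw [← hb, ← sub_eq_zero.mp h0, hx])
    rw [hx, pow_succ, ← hK, hk', h.sinh_half_sub] at hv1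
    have hsh : (Real.sinh ((γ (thetaP N j) + γ θ) / 2) : ℂ) ≠ 0 := by
      exact_mod_cast (h.sinh_half_add_pos (thetaP N j) θ).ne'
    rw [hv1, residueTerm, hk]
    generalize thetaP N j = φ at *
    have hexp : Complex.exp (Complex.I * ((φ + -θ) / 2 : ℝ)) *
        Complex.exp (Complex.I * ((φ + η) / 2 : ℝ)) = Complex.exp (Complex.I * φ) * e := by
      rw [he, ← Complex.exp_add, ← Complex.exp_add]
      congr 1
      push_cast
      ring
    rw [ha, exp_I_sub_exp_I] at hxa
    rw [hb, exp_I_sub_exp_I] at hxb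
    rw [ha, hb, exp_I_sub_exp_I, exp_I_sub_exp_I,
      mul_mul_mul_comm (Complex.exp (Complex.I * ((φ + -θ) / 2 : ℝ))), hexp]
    rw [sub_neg_eq_add, add_comm φ θ] at hxa ⊢
    have hs1 := right_ne_zero_of_mul (right_ne_zero_of_mul hxa)
    have hs2 := right_ne_zero_of_mul (right_ne_zero_of_mul hxb)
    have hx0 := Complex.exp_ne_zero (Complex.I * φ)
    clear hve hxa hxb hexp hv1 hx hab hba hK hk' hk
    clear_value e K
    simp only [Complex.ofReal_mul, Complex.ofReal_neg, Complex.ofReal_div]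
    generalize Complex.exp (Complex.I * φ) = x at *
    generalize (Real.sin ((θ + φ) / 2) : ℂ) = s1 at *
    generalize (Real.sin ((φ - η) / 2) : ℂ) = s2 at *
    generalize (Real.sin ((θ - φ) / 2) : ℂ) = s3 at *
    generalize (Real.sinh ((γ φ + γ θ) / 2) : ℂ) = sh at *
    generalize (phase u w γ φ + phase u w γ η) * (1 + (phase u w γ φ)⁻¹) = T at *
    have hI2 : (2 * Complex.I * s1) * (2 * Complex.I * s2) = -4 * s1 * s2 := by
      linear_combination 4 * s1 * s2 * Complex.I_sq
    rw [hI2]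
    field_simp
    ring
  have hterma := h.eval_at_reflected hm (hve (-θ)) hθ
  have htermb := h.eval_of_lower_branch_eq_zero hm (hve η) (exp_pow_ne_neg_one hη) (by simp)
  have hbN' := sub_ne_zero.mpr hbN
  rw [← hb, pow_succ, ← hK, hk'] at htermb
  rw [← ha, ← hK] at hterma
  rw [← ha, ← hb, sum_congr rfl fun j _ => hterm j, ← mul_sum, ← mul_sum, ← div_div (v.eval a),
    hterma, htermb, hab, hba] at hsum
  have hη0 := h.phase_ne_zero η
  have hb1 := h.one_add_phase_ne_zero θ
  have hR0 : (halfRatio N m γ θ : ℂ) ≠ 0 := by exact_mod_cast (h.halfRatio_pos θ).ne'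
  refine mul_left_cancel₀ (div_ne_zero hK0 he0) ?_
  rw [mul_zero, ← hsum]
  generalize ∑ j, residueTerm u w γ N m θ η (thetaP N j) = sj at *
  clear_value K
  clear hsum hterma htermb hterm hve hab hba
  have hI := Complex.I_ne_zero
  generalize b ^ N = bN at *
  generalize (Real.sin ((θ + η) / 2) : ℂ) = σ at *
  generalize phase u w γ θ = p at *
  generalize phase u w γ η = q at *
  generalize (halfRatio N m γ θ : ℂ) = R at *
  generalize (halfRatio N m γ η : ℂ) = R' at *
  have hc : (q + q) * (1 + q⁻¹) = 2 * (1 + q) := by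
    field_simp
    ring
  rw [hc]
  field_simp
  ring

end IsDispersion

theorem sin_half_thetaP_add_thetaA {N : ℕ} (hN : N ≠ 0) (j k : Fin N) :
    Real.sin ((thetaP N j + thetaA N k) / 2) ≠ 0 := fun h0 => by
  have h1 := exp_I_sub_exp_I (thetaP N j) (-thetaA N k)
  rw [sub_neg_eq_add, h0, Complex.ofReal_zero, mul_zero, mul_zero, sub_eq_zero] at h1
  have h2 := exp_I_mul_thetaP_pow hN j
  have h3 := exp_I_mul_thetaA_pow hN k
  rw [h1, Complex.ofReal_neg, mul_neg, Complex.exp_neg, inv_pow, h3] at h2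
  norm_num at h2

theorem sin_half_thetaP_sub_thetaA {N : ℕ} (hN : N ≠ 0) (j k : Fin N) :
    Real.sin ((thetaP N j - thetaA N k) / 2) ≠ 0 := fun h0 => by
  have h1 := exp_I_sub_exp_I (thetaP N j) (thetaA N k)
  rw [h0, Complex.ofReal_zero, mul_zero, mul_zero, sub_eq_zero] at h1
  exact exp_thetaP_ne_exp_thetaA hN j k h1

theorem sin_nat_mul_add_ne_zero {N n : ℕ} {θ t : ℝ} (hθ : N * θ = n * Real.pi)
    (ht : Real.sin (N * t) ≠ 0) : Real.sin (N * (θ + t)) ≠ 0 := by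
  rw [mul_add, hθ, add_comm, Real.sin_add_nat_mul_pi]
  exact mul_ne_zero (pow_ne_zero _ (by norm_num)) ht

theorem eventually_sin_nat_mul_ne_zero {N : ℕ} (hN : N ≠ 0) :
    ∀ᶠ t : ℝ in nhdsWithin 0 {0}ᶜ, Real.sin (N * t) ≠ 0 := by
  have hN' : (0 : ℝ) < N := by positivity
  have h1 : Set.Ioo (-(Real.pi / N)) (Real.pi / N) ∈ nhds (0 : ℝ) :=
    Ioo_mem_nhds (neg_lt_zero.mpr (by positivity)) (by positivity)
  filter_upwards [nhdsWithin_le_nhds h1, self_mem_nhdsWithin] with t ht ht0 h0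
  have h2 : N * t < Real.pi := by
    have := (lt_div_iff₀ hN').mp ht.2
    linarith
  have h3 : -Real.pi < N * t := by
    have := ht.1
    rw [← neg_div, div_lt_iff₀ hN'] at this
    linarith
  rcases mul_eq_zero.mp ((Real.sin_eq_zero_iff_of_lt_of_lt h3 h2).mp h0) with h4 | h4
  · exact hN'.ne' h4
  · exact ht0 h4

namespace IsDispersion

variable {u w : ℝ} {γ : ℝ → ℝ} {N m : ℕ}

theorem continuous_halfRatio (h : IsDispersion u w γ) : Continuous (halfRatio N m γ) := by
  have h1 := h.continuous
  unfold halfRatio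
  refine Continuous.div ?_ ?_ fun θ => (h.halfA_pos θ).ne'
  · unfold halfP
    fun_prop
  · unfold halfA
    fun_prop

/-- The residue identity at the quantised momenta, obtained from the generic one as a limit. -/
theorem sum_residueTerm (h : IsDispersion u w γ) (hm : N = 2 * m + 1 ∨ N = 2 * m + 2)
    (j k : Fin N) :
    (Real.sinh u * Real.sinh w) ^ 2 / (8 * N) *
        ∑ i, residueTerm u w γ N m (thetaP N j) (thetaA N k) (thetaP N i) =
      Real.sinh u * (phase u w γ (thetaA N k) * phase u w γ (thetaP N j) - 1) /
        ((1 + phase u w γ (thetaP N j)) * halfRatio N m γ (thetaP N j) *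
          (2 * Complex.I * Real.sin ((thetaP N j + thetaA N k) / 2))) := by
  have hN : N ≠ 0 := by omega
  have hN' : (N : ℝ) ≠ 0 := Nat.cast_ne_zero.mpr hN
  have hsin := sin_half_thetaP_add_thetaA hN j k
  have hsin' (i : Fin N) := sin_half_thetaP_sub_thetaA hN i k
  have hA := exp_I_mul_thetaA_pow hN k
  have hθN : N * thetaP N j = (2 * j : ℕ) * Real.pi := by
    rw [thetaP]
    push_cast
    field_simp
  have hηN : N * thetaA N k = (2 * k + 1 : ℕ) * Real.pi := by
    rw [thetaA]
    push_cast
    field_simp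
  set θ := thetaP N j
  set η := thetaA N k
  have hγc := h.continuous
  have hpc := h.continuous_phase
  have hRc := h.continuous_halfRatio (N := N) (m := m)
  let G : ℝ → ℂ := fun t =>
    (Real.sinh u * Real.sinh w) ^ 2 / (8 * N) *
        ∑ i, residueTerm u w γ N m (θ + t) (η + t) (thetaP N i) -
      Real.sinh u * (phase u w γ (η + t) * phase u w γ (θ + t) - 1) /
        ((1 + phase u w γ (θ + t)) * halfRatio N m γ (θ + t) *
          (2 * Complex.I * Real.sin ((θ + t + (η + t)) / 2))) +
      Real.sinh u * Real.sinh w / 4 * (Complex.exp (Complex.I * (η + t : ℝ)) ^ N + 1) /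
        (Complex.exp (Complex.I * (η + t : ℝ)) ^ N - 1) * halfRatio N m γ (η + t) *
          Real.sinh ((γ (η + t) - γ (θ + t)) / 2) * (2 * (1 + phase u w γ (η + t))) /
            (2 * Complex.I * Real.sin ((θ + t + (η + t)) / 2))
  have hG0 : ∀ᶠ t in nhdsWithin (0 : ℝ) {0}ᶜ, G t = 0 := by
    have hc : ContinuousAt (fun t : ℝ => Real.sin ((θ + t + (η + t)) / 2)) 0 := by fun_prop
    have h1 := hc.eventually_ne (y := 0) (by simpa using hsin)
    filter_upwards [nhdsWithin_le_nhds h1, eventually_sin_nat_mul_ne_zero hN] with t ht1 ht2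
    exact h.residue_identity hm (sin_nat_mul_add_ne_zero hθN ht2)
      (sin_nat_mul_add_ne_zero hηN ht2) ht1
  have hGc : ContinuousAt G 0 := by
    have hs : (2 * Complex.I * Real.sin ((θ + 0 + (η + 0)) / 2) : ℂ) ≠ 0 := by
      rw [add_zero, add_zero]
      exact mul_ne_zero (mul_ne_zero two_ne_zero Complex.I_ne_zero) (by exact_mod_cast hsin)
    refine ContinuousAt.add (ContinuousAt.sub (ContinuousAt.mul continuousAt_const
      (tendsto_finsetSum _ fun i _ => ?_)) ?_) ?_
    · change ContinuousAt (fun t => residueTerm u w γ N m (θ + t) (η + t) (thetaP N i)) 0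
      unfold residueTerm
      refine ContinuousAt.div (by fun_prop) (by fun_prop) (mul_ne_zero ?_ ?_)
      · exact_mod_cast (h.sinh_half_add_pos _ _).ne'
      · rw [add_zero]
        exact_mod_cast hsin' i
    · refine ContinuousAt.div (by fun_prop) (by fun_prop) (mul_ne_zero (mul_ne_zero ?_ ?_) hs)
      · exact h.one_add_phase_ne_zero _
      · exact_mod_cast (h.halfRatio_pos _).ne'
    · refine ContinuousAt.div (ContinuousAt.mul (ContinuousAt.mul (ContinuousAt.mul
        (ContinuousAt.div (by fun_prop) (by fun_prop) ?_) (by fun_prop)) (by fun_prop))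
        (by fun_prop)) (by fun_prop) hs
      rw [add_zero, hA]
      norm_num
  have hlim : G 0 = 0 := tendsto_nhds_unique (hGc.tendsto.mono_left nhdsWithin_le_nhds)
    (tendsto_const_nhds.congr' (hG0.mono fun t ht => ht.symm))
  simp only [G, add_zero, hA] at hlim
  rw [neg_add_cancel, mul_zero, zero_div, zero_mul, zero_mul, zero_mul, zero_div, add_zero,
    sub_eq_zero] at hlim
  exact hlim

end IsDispersion

/-- The closed form of `B D⁻¹`, in terms of half products. -/
def quotientMat (N m : ℕ) (l : ℤ) (α β u w : ℝ) (γ : ℝ → ℝ) : Matrix (Fin N) (Fin N) ℂ :=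
  Matrix.of fun j i =>
    -Complex.I * Complex.exp (Complex.I * ((l : ℂ) - 2⁻¹) * (thetaP N j + thetaP N i)) *
      (Real.sinh u * Real.sinh w ^ 2) *
      (halfRatio N m γ (thetaP N j) * (sqb α β (thetaP N j)).re) *
      (halfRatio N m γ (thetaP N i) * (sqb α β (thetaP N i)).re) / N *
      Real.sin ((thetaP N j - thetaP N i) / 2) /
        Real.sinh ((γ (thetaP N j) + γ (thetaP N i)) / 2)

namespace IsDispersion

variable {u w α β : ℝ} {γ : ℝ → ℝ} {N m : ℕ}

theorem sqb_neg_add (h : IsDispersion u w γ)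
    (hq : ∀ θ, sqb α β θ ^ 2 = phase u w γ θ ∧ 0 < (sqb α β θ).re ∧
      (starRingEnd ℂ) (sqb α β θ) = (sqb α β θ)⁻¹) (θ : ℝ) (n : ℕ) :
    sqb α β (-θ + n * (2 * Real.pi)) = (sqb α β θ)⁻¹ := by
  have h1 : phase u w γ (-θ + n * (2 * Real.pi)) = phase u w γ (-θ) := by
    have hc : Real.cos (-θ + n * (2 * Real.pi)) = Real.cos (-θ) := Real.cos_add_nat_mul_two_pi _ _
    have hs : Real.sin (-θ + n * (2 * Real.pi)) = Real.sin (-θ) := Real.sin_add_nat_mul_two_pi _ _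
    rw [phase, phase, symb, symb, hc, hs, h.gamma_congr hc]
  have h2 : 0 < ((sqb α β θ)⁻¹).re := by
    rw [← (hq θ).2.2, Complex.conj_re]
    exact (hq θ).2.1
  have h3 := cpow_inv_two_eq (hq (-θ + n * (2 * Real.pi))).2.1
    ((hq _).1.trans (h1.trans (h.phase_neg θ)))
  have h4 := cpow_inv_two_eq h2 (x := (phase u w γ θ)⁻¹) (by rw [inv_pow, (hq θ).1])
  rw [← h3, h4]

theorem conj_Cmat_apply
    (hq : ∀ θ, sqb α β θ ^ 2 = phase u w γ θ ∧ 0 < (sqb α β θ).re ∧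
      (starRingEnd ℂ) (sqb α β θ) = (sqb α β θ)⁻¹) (l : ℤ) (j k : Fin N) :
    ((Cmat N l α β).map (starRingEnd ℂ)) j k =
      Complex.exp (Complex.I * ((l : ℂ) - 2⁻¹) * (thetaP N j + thetaA N k)) /
        (2 * Complex.I * N * Real.sin ((thetaP N j + thetaA N k) / 2)) *
        (sqb α β (thetaP N j) * sqb α β (thetaA N k) -
          (sqb α β (thetaP N j))⁻¹ * (sqb α β (thetaA N k))⁻¹) := by
  have hsin : Complex.sin (((thetaP N j : ℂ) + thetaA N k) / 2) =
      (Real.sin ((thetaP N j + thetaA N k) / 2) : ℝ) := by push_cast; rfl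
  have hconj : (starRingEnd ℂ) ((2 : ℂ)⁻¹) = 2⁻¹ := by
    rw [map_inv₀, Complex.conj_ofNat]
  simp only [Matrix.map_apply, Cmat, Matrix.of_apply]
  rw [hsin]
  simp only [map_mul, map_div₀, map_inv₀, map_sub, map_add, map_neg, ← Complex.exp_conj,
    Complex.conj_I, Complex.conj_ofReal, map_natCast, map_intCast, Complex.conj_ofNat, hconj,
    (hq _).2.2, neg_neg, one_div, mul_inv, inv_inv]
  ring

theorem quotientMat_mul_Dmat (h : IsDispersion u w γ) (hm : N = 2 * m + 1 ∨ N = 2 * m + 2)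
    (hq : ∀ θ, sqb α β θ ^ 2 = phase u w γ θ ∧ 0 < (sqb α β θ).re ∧
      (starRingEnd ℂ) (sqb α β θ) = (sqb α β θ)⁻¹) (l : ℤ) :
    quotientMat N m l α β u w γ * Dmat N l α β = (Cmat N l α β).map (starRingEnd ℂ) := by
  have hN : N ≠ 0 := by omega
  have hN' : (N : ℂ) ≠ 0 := Nat.cast_ne_zero.mpr hN
  have hS : (Real.sinh u : ℂ) ≠ 0 := by exact_mod_cast h.sinh_u_pos.ne'
  have hS' : (Real.sinh w : ℂ) ≠ 0 := by exact_mod_cast h.sinh_w_pos.ne'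
  have hq0 (θ : ℝ) : sqb α β θ ≠ 0 := fun h0 => by simpa [h0] using (hq θ).2.1
  have hqre (θ : ℝ) : ((sqb α β θ).re : ℂ) = (sqb α β θ + (sqb α β θ)⁻¹) / 2 := by
    rw [← (hq θ).2.2, Complex.add_conj]
    push_cast
    ring
  ext j k
  rw [conj_Cmat_apply hq, Matrix.mul_apply]
  have hsum := h.sum_residueTerm hm j k
  have hsin := sin_half_thetaP_add_thetaA hN j k
  have hterm : ∀ i, quotientMat N m l α β u w γ j i * Dmat N l α β i k =
      Complex.exp (Complex.I * ((l : ℂ) - 2⁻¹) * (thetaP N j + thetaA N k)) *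
        (Real.sinh u * Real.sinh w ^ 2) * halfRatio N m γ (thetaP N j) *
          (sqb α β (thetaP N j)).re / (4 * N ^ 2 * sqb α β (thetaA N k)) *
        residueTerm u w γ N m (thetaP N j) (thetaA N k) (thetaP N i) := by
    intro i
    have hsini : (Real.sin ((thetaP N i - thetaA N k) / 2) : ℂ) ≠ 0 := by
      exact_mod_cast sin_half_thetaP_sub_thetaA hN i k
    have hsh : (Real.sinh ((γ (thetaP N i) + γ (thetaP N j)) / 2) : ℂ) ≠ 0 := by
      exact_mod_cast (h.sinh_half_add_pos (thetaP N i) (thetaP N j)).ne'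
    have hsin' : Complex.sin (((thetaA N k : ℂ) - thetaP N i) / 2) =
        -(Real.sin ((thetaP N i - thetaA N k) / 2) : ℝ) := by
      rw [Complex.ofReal_sin, ← Complex.sin_neg]
      push_cast
      ring_nf
    have hexp : Complex.exp (Complex.I * ((l : ℂ) - 2⁻¹) * (thetaP N j + thetaP N i)) *
        Complex.exp (-Complex.I * ((l : ℂ) - 2⁻¹) * (thetaP N i - thetaA N k)) =
        Complex.exp (Complex.I * ((l : ℂ) - 2⁻¹) * (thetaP N j + thetaA N k)) := by
      rw [← Complex.exp_add]
      ring_nf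
    simp only [quotientMat, Dmat, Matrix.of_apply]
    rw [residueTerm, ← (hq _).1, ← (hq _).1, hqre (thetaP N i), hsin', ← hexp,
      add_comm (γ (thetaP N j))]
    have hi0 := hq0 (thetaP N i)
    have hk0 := hq0 (thetaA N k)
    generalize thetaP N i = φ at *
    generalize thetaP N j = θ at *
    generalize thetaA N k = η at *
    generalize (Real.sin ((φ - η) / 2) : ℂ) = s at *
    generalize (Real.sinh ((γ φ + γ θ) / 2) : ℂ) = sh at *
    generalize Complex.exp (Complex.I * ((l : ℂ) - 2⁻¹) * (θ + φ)) = e1 at *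
    generalize Complex.exp (-Complex.I * ((l : ℂ) - 2⁻¹) * (φ - η)) = e2 at *
    have hI := Complex.I_ne_zero
    field_simp
    ring
  rw [sum_congr rfl fun i _ => hterm i, ← mul_sum]
  rw [← (hq _).1, ← (hq _).1] at hsum
  have hj1 : 1 + sqb α β (thetaP N j) ^ 2 ≠ 0 := by
    rw [(hq _).1]
    exact h.one_add_phase_ne_zero _
  have hR : (halfRatio N m γ (thetaP N j) : ℂ) ≠ 0 := by exact_mod_cast (h.halfRatio_pos _).ne'
  have hs0 : (Real.sin ((thetaP N j + thetaA N k) / 2) : ℂ) ≠ 0 := by exact_mod_cast hsin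
  have hj0 := hq0 (thetaP N j)
  have hk0 := hq0 (thetaA N k)
  have hI := Complex.I_ne_zero
  rw [hqre]
  clear hterm hq hqre
  generalize ∑ i, residueTerm u w γ N m (thetaP N j) (thetaA N k) (thetaP N i) = sr at *
  generalize (Real.sin ((thetaP N j + thetaA N k) / 2) : ℂ) = s at *
  generalize Complex.exp (Complex.I * ((l : ℂ) - 2⁻¹) * (thetaP N j + thetaA N k)) = e1 at *
  generalize (halfRatio N m γ (thetaP N j) : ℂ) = R at *
  generalize sqb α β (thetaP N j) = q at *
  generalize sqb α β (thetaA N k) = q' at *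
  have hsr : sr = 8 * N * (q' ^ 2 * q ^ 2 - 1) /
      (Real.sinh u * Real.sinh w ^ 2 * ((1 + q ^ 2) * R * (2 * Complex.I * s))) := by
    field_simp at hsum ⊢
    linear_combination hsum
  rw [hsr]
  field_simp
  ring

end IsDispersion

theorem exists_reflected_thetaP {N : ℕ} (j : Fin N) :
    ∃ (i : Fin N) (n : ℕ), thetaP N i = -thetaP N j + n * (2 * Real.pi) := by
  have hj := j.isLt
  rcases Nat.eq_zero_or_pos (j : ℕ) with h0 | h0
  · refine ⟨j, 0, ?_⟩
    simp [thetaP, h0]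
  · refine ⟨⟨N - j, by omega⟩, 1, ?_⟩
    rw [Nat.cast_one, one_mul]
    exact pAngle_reflect (i := N - j) (k := (j : ℕ)) (by omega) (by omega)

namespace IsDispersion

variable {u w α β : ℝ} {γ : ℝ → ℝ} {N m : ℕ}

theorem Dmat_add_reflected (h : IsDispersion u w γ) (hN : N ≠ 0)
    (hq : ∀ θ, sqb α β θ ^ 2 = phase u w γ θ ∧ 0 < (sqb α β θ).re ∧
      (starRingEnd ℂ) (sqb α β θ) = (sqb α β θ)⁻¹) (l : ℤ) {i j : Fin N} {n : ℕ}
    (hij : thetaP N i = -thetaP N j + n * (2 * Real.pi)) (k : Fin N) :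
    Dmat N l α β j k + ((Cmat N l α β).map (starRingEnd ℂ)) i k =
      (-2 / N * Complex.exp (-Complex.I * (l - 1) * thetaP N j) * (sqb α β (thetaP N j))⁻¹) *
        (1 / (Complex.exp (Complex.I * thetaP N j) - Complex.exp (Complex.I * thetaA N k))) *
        (Complex.exp (Complex.I * l * thetaA N k) * sqb α β (thetaA N k)) := by
  have hN' : (N : ℂ) ≠ 0 := Nat.cast_ne_zero.mpr hN
  have hq0 (θ : ℝ) : sqb α β θ ≠ 0 := fun h0 => by simpa [h0] using (hq θ).2.1
  have hs0 : (Real.sin ((thetaP N j - thetaA N k) / 2) : ℂ) ≠ 0 := by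
    exact_mod_cast sin_half_thetaP_sub_thetaA hN j k
  rw [conj_Cmat_apply hq, hij, h.sqb_neg_add hq, exp_I_sub_exp_I]
  simp only [Dmat, Matrix.of_apply]
  have hsin : Complex.sin (((thetaA N k : ℂ) - thetaP N j) / 2) =
      -(Real.sin ((thetaP N j - thetaA N k) / 2) : ℝ) := by
    rw [Complex.ofReal_sin, ← Complex.sin_neg]
    push_cast
    ring_nf
  have hsin' : Real.sin ((-thetaP N j + n * (2 * Real.pi) + thetaA N k) / 2) =
      -((-1) ^ n * Real.sin ((thetaP N j - thetaA N k) / 2)) := by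
    rw [show (-thetaP N j + n * (2 * Real.pi) + thetaA N k) / 2 =
      -((thetaP N j - thetaA N k) / 2) + n * Real.pi by ring, Real.sin_add_nat_mul_pi,
      Real.sin_neg, mul_neg]
  have hexp : Complex.exp (Complex.I * ((l : ℂ) - 2⁻¹) *
      (((-thetaP N j + n * (2 * Real.pi) : ℝ) : ℂ) + thetaA N k)) =
      (-1) ^ n * Complex.exp (-Complex.I * ((l : ℂ) - 2⁻¹) * (thetaP N j - thetaA N k)) := by
    have h1 : Complex.I * ((l : ℂ) - 2⁻¹) *
        (((-thetaP N j + n * (2 * Real.pi) : ℝ) : ℂ) + thetaA N k) =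
        -Complex.I * ((l : ℂ) - 2⁻¹) * (thetaP N j - thetaA N k) - n * (Real.pi * Complex.I) +
          (l * n : ℤ) * (2 * Real.pi * Complex.I) := by
      push_cast
      ring
    rw [h1, Complex.exp_add, Complex.exp_sub, Complex.exp_int_mul_two_pi_mul_I,
      Complex.exp_nat_mul, Complex.exp_pi_mul_I, mul_one, div_eq_mul_inv, ← inv_pow,
      inv_neg_one, mul_comm]
  have hexp' : Complex.exp (-Complex.I * (l - 1) * thetaP N j) *
      Complex.exp (Complex.I * l * thetaA N k) =
      Complex.exp (-Complex.I * ((l : ℂ) - 2⁻¹) * (thetaP N j - thetaA N k)) *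
        Complex.exp (Complex.I * ((thetaP N j + thetaA N k) / 2 : ℝ)) := by
    rw [← Complex.exp_add, ← Complex.exp_add]
    congr 1
    push_cast
    ring
  have he0 := Complex.exp_ne_zero (Complex.I * ((thetaP N j + thetaA N k) / 2 : ℝ))
  have hone : ((-1 : ℂ) ^ n) ≠ 0 := pow_ne_zero _ (by norm_num)
  have hj0 := hq0 (thetaP N j)
  have hk0 := hq0 (thetaA N k)
  have hI := Complex.I_ne_zero
  rw [hsin, hsin', hexp, Complex.ofReal_neg, Complex.ofReal_mul, Complex.ofReal_pow,
    Complex.ofReal_neg, Complex.ofReal_one]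
  clear hsin hsin' hexp hq0 hij hq
  generalize (Real.sin ((thetaP N j - thetaA N k) / 2) : ℂ) = s at *
  generalize Complex.exp (-Complex.I * ((l : ℂ) - 2⁻¹) * (thetaP N j - thetaA N k)) = E at *
  generalize Complex.exp (Complex.I * ((thetaP N j + thetaA N k) / 2 : ℝ)) = e at *
  generalize Complex.exp (-Complex.I * (l - 1) * thetaP N j) = eP at *
  generalize Complex.exp (Complex.I * l * thetaA N k) = eA at *
  generalize sqb α β (thetaP N j) = q at *
  generalize sqb α β (thetaA N k) = q' at *
  generalize (-1 : ℂ) ^ n = ε at *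
  field_simp
  linear_combination 2 * q' ^ 2 * hexp'

theorem det_Dmat_ne_zero (h : IsDispersion u w γ) (hm : N = 2 * m + 1 ∨ N = 2 * m + 2)
    (hq : ∀ θ, sqb α β θ ^ 2 = phase u w γ θ ∧ 0 < (sqb α β θ).re ∧
      (starRingEnd ℂ) (sqb α β θ) = (sqb α β θ)⁻¹) (l : ℤ) :
    (Dmat N l α β).det ≠ 0 := by
  have hN : N ≠ 0 := by omega
  have hN' : (N : ℂ) ≠ 0 := Nat.cast_ne_zero.mpr hN
  have hq0 (θ : ℝ) : sqb α β θ ≠ 0 := fun h0 => by simpa [h0] using (hq θ).2.1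
  choose σ n hσ using exists_reflected_thetaP (N := N)
  have hfac : (1 + (quotientMat N m l α β u w γ).submatrix σ id) * Dmat N l α β =
      Matrix.diagonal (fun j => -2 / N * Complex.exp (-Complex.I * (l - 1) * thetaP N j) *
          (sqb α β (thetaP N j))⁻¹) *
        Matrix.of (fun j k => 1 / (Complex.exp (Complex.I * thetaP N j) -
          Complex.exp (Complex.I * thetaA N k))) *
        Matrix.diagonal (fun k => Complex.exp (Complex.I * l * thetaA N k) *
          sqb α β (thetaA N k)) := by
    ext j k
    rw [add_mul, one_mul, Matrix.add_apply, Matrix.mul_diagonal, Matrix.diagonal_mul,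
      Matrix.of_apply, ← h.Dmat_add_reflected hN hq l (hσ j) k, ← h.quotientMat_mul_Dmat hm hq]
    rfl
  have hdet := congrArg Matrix.det hfac
  rw [Matrix.det_mul, Matrix.det_mul, Matrix.det_mul, Matrix.det_diagonal,
    Matrix.det_diagonal] at hdet
  intro h0
  rw [h0, mul_zero] at hdet
  refine mul_ne_zero (mul_ne_zero (prod_ne_zero_iff.mpr fun j _ => ?_) (det_cauchy_ne_zero
    (exp_I_mul_thetaP_injective hN) (exp_I_mul_thetaA_injective hN)
    (exp_thetaP_ne_exp_thetaA hN))) (prod_ne_zero_iff.mpr fun k _ => ?_) hdet.symm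
  · exact mul_ne_zero (mul_ne_zero (div_ne_zero (by norm_num) hN') (Complex.exp_ne_zero _))
      (inv_ne_zero (hq0 _))
  · exact mul_ne_zero (Complex.exp_ne_zero _) (hq0 _)

theorem exp_neg_nufun_half (h : IsDispersion u w γ) (hm : N = 2 * m + 1 ∨ N = 2 * m + 2)
    {q : ℂ} {θ : ℝ} (hq : q ^ 2 = phase u w γ θ) (hre : 0 < q.re)
    (hconj : (starRingEnd ℂ) q = q⁻¹) :
    Real.exp (-nufun N γ θ / 2) =
      halfRatio N m γ θ * q.re * (√(Real.sinh w) * √(Real.sinh (γ θ))) := by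
  set F : ℝ → ℝ := fun φ => Real.sinh ((γ θ + γ φ) / 2) with hF
  have hFp : Function.Periodic F (2 * Real.pi) := fun φ => by
    simp only [hF, h.gamma_congr (Real.cos_add_two_pi φ)]
  have hFn (φ : ℝ) : F (-φ) = F φ := by simp only [hF, h.gamma_congr (Real.cos_neg φ)]
  have hF0 (φ : ℝ) : 0 < F φ := h.sinh_half_add_pos θ φ
  have hA := prod_thetaA_mul hm hFp
  have hP := prod_thetaP_mul hm hFp
  simp only [hFn] at hA hP
  rw [prod_mul_distrib] at hA hP
  have hA' : ∏ k ∈ range (m + 1), F (aAngle N k) = halfA N m γ (γ θ) := rfl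
  have hP' : ∏ k ∈ range m, F (pAngle N (k + 1)) = halfP N m γ (γ θ) := rfl
  rw [hA'] at hA
  rw [hP'] at hP
  set e : ℝ := if Even N then 1 else F Real.pi with he
  have he0 : 0 < e := by
    rw [he]
    split_ifs
    · exact one_pos
    · exact hF0 _
  have hpA : 0 < ∏ j : Fin N, F (thetaA N j) := prod_pos fun j _ => hF0 _
  have hpP : 0 < ∏ j : Fin N, F (thetaP N j) := prod_pos fun j _ => hF0 _
  have hν : Real.exp (-nufun N γ θ) =
      (∏ j : Fin N, F (thetaP N j)) / ∏ j : Fin N, F (thetaA N j) := by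
    rw [Real.exp_neg, nufun, Real.exp_log (div_pos hpA hpP), inv_div]
  have hh := h.halfA_pos (N := N) (m := m) θ
  have hsym : (symb u w θ).re = Real.sinh (γ θ) * (2 * q.re ^ 2 - 1) := by
    have h1 : q.re ^ 2 + q.im ^ 2 = 1 := by
      have h2 : q * (starRingEnd ℂ) q = 1 := by
        rw [hconj, mul_inv_cancel₀]
        rintro rfl
        simp at hre
      rw [Complex.mul_conj, Complex.normSq_apply] at h2
      have h3 : q.re * q.re + q.im * q.im = 1 := by exact_mod_cast h2
      linarith
    rw [← h.sinh_mul_phase, ← hq, Complex.re_ofReal_mul, pow_two, Complex.mul_re]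
    linear_combination -Real.sinh (γ θ) * h1
  have hFF : F 0 * F Real.pi = Real.sinh w * Real.sinh (γ θ) * q.re ^ 2 := by
    rw [hF, h.sinh_zero_mul_sinh_pi, hsym]
    ring
  have hsw := Real.sq_sqrt h.sinh_w_pos.le
  have hsg := Real.sq_sqrt (h.sinh_gamma_pos θ).le
  refine (pow_left_inj₀ (Real.exp_pos _).le (mul_nonneg (mul_nonneg (h.halfRatio_pos θ).le hre.le)
    (mul_nonneg (Real.sqrt_nonneg _) (Real.sqrt_nonneg _))) two_ne_zero).mp ?_
  rw [← Real.exp_nat_mul, Nat.cast_ofNat, mul_div_cancel₀ _ two_ne_zero, hν, mul_pow, mul_pow,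
    mul_pow, hsw, hsg, halfRatio, div_pow, eq_comm, eq_div_iff hpA.ne']
  refine mul_right_cancel₀ he0.ne' ?_
  rw [mul_assoc, hA, hP, hFF]
  field_simp

end IsDispersion

theorem sinh_two_mul_mul_sinh_two_mul {K K' : ℝ} (h : Real.tanh K' = Real.exp (-(2 * K))) :
    Real.sinh (2 * K) * Real.sinh (2 * K') = 1 := by
  have hc := Real.cosh_pos K'
  have hsq := Real.cosh_sq K'
  have hs : Real.sinh K' = Real.exp (-(2 * K)) * Real.cosh K' := by
    rw [← h, Real.tanh_eq_sinh_div_cosh, div_mul_cancel₀ _ hc.ne']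
  have he : Real.exp (2 * K) * Real.exp (-(2 * K)) = 1 := by
    rw [← Real.exp_add, add_neg_cancel, Real.exp_zero]
  rw [Real.sinh_two_mul K', Real.sinh_eq (2 * K)]
  rw [hs] at hsq ⊢
  linear_combination Real.cosh K' ^ 2 * he + hsq

theorem B_Dinv_formula
    (N : ℕ) (hN : 1 ≤ N) (l : ℤ) (Kx Ky Kxs : ℝ)
    (hKx : 0 < Kx) (hKy : 0 < Ky)
    (hKxs_pos : 0 < Kxs) (hKxs : Real.tanh Kxs = Real.exp (-(2 * Kx)))
    (α β : ℝ)
    (hα : α = Real.tanh Kxs * (Real.cosh Ky / Real.sinh Ky))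
    (hβ : β = Real.tanh Kxs * Real.tanh Ky)
    (hferro : Kxs < Ky)
    (γ : ℝ → ℝ) (hγ_nonneg : ∀ θ, 0 ≤ γ θ)
    (hγ : ∀ θ, Real.cosh (γ θ) =
      Real.cosh (2 * Kxs) * Real.cosh (2 * Ky) -
        Real.sinh (2 * Kxs) * Real.sinh (2 * Ky) * Real.cos θ) :
    IsUnit (Dmat N l α β).det ∧
      ∀ j k : Fin N,
        ((Cmat N l α β).map (starRingEnd ℂ) * (Dmat N l α β)⁻¹) j k =
          -Complex.I *
              Complex.exp (Complex.I * ((l : ℂ) - 2⁻¹) *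
                ((thetaP N j : ℝ) + (thetaP N k : ℝ))) *
              ((Real.sinh (2 * Ky) / Real.sinh (2 * Kx) : ℝ) : ℂ) *
              ((Real.exp (-(nufun N γ (thetaP N j) + nufun N γ (thetaP N k)) / 2) : ℝ) : ℂ) /
              ((N : ℂ) *
                ((Real.sqrt (Real.sinh (γ (thetaP N j)) * Real.sinh (γ (thetaP N k))) : ℝ) : ℂ)) *
              Complex.sin ((((thetaP N j : ℝ) : ℂ) - (thetaP N k : ℝ)) / 2) /
              ((Real.sinh ((γ (thetaP N j) + γ (thetaP N k)) / 2) : ℝ) : ℂ) := by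
  have h : IsDispersion (2 * Kxs) (2 * Ky) γ :=
    ⟨by linarith, by linarith, hγ_nonneg, hγ⟩
  have hm : N = 2 * ((N - 1) / 2) + 1 ∨ N = 2 * ((N - 1) / 2) + 2 := by omega
  have hq := fun θ => sqb_properties h hα hβ θ
  have hdet : IsUnit (Dmat N l α β).det := isUnit_iff_ne_zero.mpr (h.det_Dmat_ne_zero hm hq l)
  refine ⟨hdet, fun j k => ?_⟩
  rw [← h.quotientMat_mul_Dmat hm hq, Matrix.mul_nonsing_inv_cancel_right _ _ hdet]
  have hν (θ : ℝ) := h.exp_neg_nufun_half hm (hq θ).1 (hq θ).2.1 (hq θ).2.2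
  have hexp : Real.exp (-(nufun N γ (thetaP N j) + nufun N γ (thetaP N k)) / 2) =
      Real.exp (-nufun N γ (thetaP N j) / 2) * Real.exp (-nufun N γ (thetaP N k) / 2) := by
    rw [← Real.exp_add]
    ring_nf
  have hK := sinh_two_mul_mul_sinh_two_mul hKxs
  have hratio : Real.sinh (2 * Ky) / Real.sinh (2 * Kx) =
      Real.sinh (2 * Kxs) * Real.sinh (2 * Ky) := by
    rw [div_eq_iff (left_ne_zero_of_mul_eq_one hK)]
    linear_combination -Real.sinh (2 * Ky) * hK
  have hsin : Complex.sin (((thetaP N j : ℂ) - thetaP N k) / 2) =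
      (Real.sin ((thetaP N j - thetaP N k) / 2) : ℝ) := by
    push_cast
    rfl
  have hw : ((√(Real.sinh (2 * Ky)) : ℝ) : ℂ) ^ 2 = (Real.sinh (2 * Ky) : ℝ) := by
    exact_mod_cast Real.sq_sqrt h.sinh_w_pos.le
  have hj : ((√(Real.sinh (γ (thetaP N j))) : ℝ) : ℂ) ≠ 0 := by
    exact_mod_cast (Real.sqrt_pos.mpr (h.sinh_gamma_pos _)).ne'
  have hk : ((√(Real.sinh (γ (thetaP N k))) : ℝ) : ℂ) ≠ 0 := by
    exact_mod_cast (Real.sqrt_pos.mpr (h.sinh_gamma_pos _)).ne'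
  rw [hexp, hν, hν, hratio, hsin, Real.sqrt_mul (h.sinh_gamma_pos _).le, quotientMat,
    Matrix.of_apply]
  simp only [Complex.ofReal_mul]
  rw [← hw]
  field_simp
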